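/- arXiv:2204.12051 — 3 statements merged into one kernel-verified Lean document; each statement's English description precedes it below -/
import Mathlib

section
/- A unitary U on (ℂ^d)^{⊗n} satisfies CiS[U] = 0 if and only if U belongs to the subgroup of the unitary group of (ℂ^d)^{⊗n} generated by the single-qudit unitaries (unitaries of the form I ⊗ ⋯ ⊗ W ⊗ ⋯ ⊗ I with W a unitary on one tensor factor and identity on all others) together with the swap unitaries SWAP_{ij} (the unitaries that exchange the i-th and j-th tensor factors and act as the identity on all others). -/
open Matrix Complex BigOperators
open scoped ComplexOrder
noncomputable section

namespace QC

/-- Operators on the `n`-qudit space `(ℂ^d)^{⊗n}`, as matrices indexed by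
computational basis labels `Fin n → Fin d`. -/
abbrev QOp (d n : ℕ) := Matrix (Fin n → Fin d) (Fin n → Fin d) ℂ

/-- The qudit shift operator `X`, with `X|j⟩ = |j+1 mod d⟩`. -/
def shiftX (d : ℕ) : Matrix (Fin d) (Fin d) ℂ :=
  fun i j => if (i : ℕ) = ((j : ℕ) + 1) % d then 1 else 0

/-- The qudit clock operator `Z`, with `Z|j⟩ = e^{2πij/d}|j⟩`. -/
def clockZ (d : ℕ) : Matrix (Fin d) (Fin d) ℂ :=
  Matrix.diagonal (fun j => Complex.exp (2 * Real.pi * Complex.I * (j : ℕ) / d))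

/-- The single-qudit Pauli operator `P_a = X^s Z^t` for `a = (s,t) ∈ ℤ_d × ℤ_d`. -/
def pauli1 (d : ℕ) (a : ZMod d × ZMod d) : Matrix (Fin d) (Fin d) ℂ :=
  shiftX d ^ a.1.val * clockZ d ^ a.2.val

/-- The `n`-qudit Pauli operator `P_ā = P_{a_1} ⊗ ⋯ ⊗ P_{a_n}`. -/
def pauliN (d n : ℕ) (a : Fin n → ZMod d × ZMod d) : QOp d n :=
  fun x y => ∏ i, pauli1 d (a i) (x i) (y i)

/-- The weight `|ā|`: the number of indices `i` with `a_i ≠ (0,0)`. -/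
def weight (d n : ℕ) (a : Fin n → ZMod d × ZMod d) : ℕ :=
  (Finset.univ.filter (fun i => a i ≠ 0)).card

/-- `P_O[ā] = |Tr(O P_ā)|² / d^{2n}`. -/
def pdist (d n : ℕ) (O : QOp d n) (a : Fin n → ZMod d × ZMod d) : ℝ :=
  ‖(O * pauliN d n a).trace‖ ^ 2 / (d : ℝ) ^ (2 * n)

/-- The normalized 2-norm `‖O‖₂ = (Tr(O†O)/d^n)^{1/2}`. -/
def l2norm (d n : ℕ) (O : QOp d n) : ℝ :=
  Real.sqrt (((Oᴴ * O).trace).re / (d : ℝ) ^ n)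

/-- The total influence `I[O] = Σ_ā |ā|·P_O[ā]`. -/
def influence (d n : ℕ) [NeZero d] (O : QOp d n) : ℝ :=
  ∑ a : Fin n → ZMod d × ZMod d, (weight d n a : ℝ) * pdist d n O a

/-- The local influence `I_j[O] = Σ_{ā : a_j ≠ 0} P_O[ā]`. -/
def localInfluence (d n : ℕ) [NeZero d] (j : Fin n) (O : QOp d n) : ℝ :=
  ∑ a ∈ Finset.univ.filter (fun a : Fin n → ZMod d × ZMod d => a j ≠ 0), pdist d n O a

/-- The quantum Fourier entropy `H[O] = -Σ_ā P_O[ā] log₂ P_O[ā]` (with `0·log 0 = 0`). -/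
def qEntropy (d n : ℕ) [NeZero d] (O : QOp d n) : ℝ :=
  -∑ a : Fin n → ZMod d × ZMod d, pdist d n O a * Real.logb 2 (pdist d n O a)

/-- The binary entropy `h(x) = -x log₂ x - (1-x) log₂ (1-x)`. -/
def binEntropy (x : ℝ) : ℝ :=
  -(x * Real.logb 2 x) - (1 - x) * Real.logb 2 (1 - x)

/-- Circuit sensitivity `CiS[U] = sup { |I[UOU†] - I[O]| : ‖O‖₂ = 1 }`. -/
def CiS (d n : ℕ) [NeZero d] (U : QOp d n) : ℝ :=
  sSup {x : ℝ | ∃ O : QOp d n, l2norm d n O = 1 ∧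
    x = |influence d n (U * O * Uᴴ) - influence d n O|}

/-- Magic power `𝓜[U] = sup { |H[UOU†] - H[O]| : ‖O‖₂ = 1 }`. -/
def magicPower (d n : ℕ) [NeZero d] (U : QOp d n) : ℝ :=
  sSup {x : ℝ | ∃ O : QOp d n, l2norm d n O = 1 ∧
    x = |qEntropy d n (U * O * Uᴴ) - qEntropy d n O|}

/-- Magic entropy `M[U] = max { H[U P_ā U†] : |ā| = 1 }`. -/
def magicEntropy (d n : ℕ) [NeZero d] (U : QOp d n) : ℝ :=
  sSup {x : ℝ | ∃ a : Fin n → ZMod d × ZMod d, weight d n a = 1 ∧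
    x = qEntropy d n (U * pauliN d n a * Uᴴ)}

/-- The operator norm `‖A‖∞` (the L2 → L2 operator norm). -/
def opNorm (d n : ℕ) (A : QOp d n) : ℝ :=
  ‖Matrix.toEuclideanCLM (𝕜 := ℂ) (n := Fin n → Fin d) A‖

/-- The influence rate `R_I(H,O)`. -/
def influenceRate (d n : ℕ) [NeZero d] (H O : QOp d n) : ℂ :=
  (Complex.I / (d : ℂ) ^ (2 * n)) * ∑ a : Fin n → ZMod d × ZMod d, (weight d n a : ℂ) *
    (((O * H - H * O) * pauliN d n a).trace * (O * (pauliN d n a)ᴴ).trace +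
     ((O * H - H * O) * (pauliN d n a)ᴴ).trace * (O * pauliN d n a).trace)

/-- The magic rate `R_M(H,O)`. -/
def magicRate (d n : ℕ) [NeZero d] (H O : QOp d n) : ℂ :=
  (Complex.I / (d : ℂ) ^ (2 * n)) * ∑ a : Fin n → ZMod d × ZMod d,
    (((O * H - H * O) * pauliN d n a).trace * (O * (pauliN d n a)ᴴ).trace +
     ((O * H - H * O) * (pauliN d n a)ᴴ).trace * (O * pauliN d n a).trace) *
    (Real.logb 2 (pdist d n O a) : ℂ)

/-- Extend an operator on the first `k` qudits by the identity: `H₀ ⊗ I`. -/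
def extendOp (d k n : ℕ) (h : k ≤ n) (H0 : QOp d k) : QOp d n :=
  fun x y => if ∀ i : Fin n, k ≤ (i : ℕ) → x i = y i
    then H0 (fun i => x (Fin.castLE h i)) (fun i => y (Fin.castLE h i)) else 0

/-- The tensor product `A ⊗ B` of an `n₁`-qudit and an `n₂`-qudit operator. -/
def tensorOp (d n₁ n₂ : ℕ) (A : QOp d n₁) (B : QOp d n₂) : QOp d (n₁ + n₂) :=
  fun x y => A (fun i => x (Fin.castAdd n₂ i)) (fun i => y (Fin.castAdd n₂ i)) *
             B (fun i => x (Fin.natAdd n₁ i)) (fun i => y (Fin.natAdd n₁ i))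

/-- Embed a single-qudit operator `W` at position `j` (identity elsewhere). -/
def embedAt (d n : ℕ) (j : Fin n) (W : Matrix (Fin d) (Fin d) ℂ) : QOp d n :=
  fun x y => if ∀ i, i ≠ j → x i = y i then W (x j) (y j) else 0

/-- The swap unitary exchanging qudits `i` and `j`. -/
def swapOp (d n : ℕ) (i j : Fin n) : QOp d n :=
  fun x y => if x = y ∘ Equiv.swap i j then 1 else 0

/-- The qubit Pauli X matrix. -/
def pauliX : Matrix (Fin 2) (Fin 2) ℂ := !![0, 1; 1, 0]

/-- The qubit Pauli Y matrix. -/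
def pauliY : Matrix (Fin 2) (Fin 2) ℂ := !![0, -Complex.I; Complex.I, 0]

/-- The qubit Pauli Z matrix. -/
def pauliZ : Matrix (Fin 2) (Fin 2) ℂ := !![1, 0; 0, -1]

/-- The ordered product `γ^S = ∏_{i∈S} γ_i` (factors in increasing index order). -/
def gammaProd (n : ℕ) (γ : Fin (2 * n) → QOp 2 n) (S : Finset (Fin (2 * n))) : QOp 2 n :=
  ((S.sort (· ≤ ·)).map γ).prod

/-- `P^G_O[S] = |Tr((γ^S)† O)|² / 2^{2n}`. -/
def pdistG (n : ℕ) (γ : Fin (2 * n) → QOp 2 n) (O : QOp 2 n) (S : Finset (Fin (2 * n))) : ℝ :=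
  ‖((gammaProd n γ S)ᴴ * O).trace‖ ^ 2 / (2 : ℝ) ^ (2 * n)

/-- The Gaussian influence `I^G[O] = Σ_S |S|·P^G_O[S]`. -/
def influenceG (n : ℕ) (γ : Fin (2 * n) → QOp 2 n) (O : QOp 2 n) : ℝ :=
  ∑ S : Finset (Fin (2 * n)), (S.card : ℝ) * pdistG n γ O S

/-- The Gaussian Fourier entropy `H^G[O] = -Σ_S P^G_O[S] log₂ P^G_O[S]`. -/
def entropyG (n : ℕ) (γ : Fin (2 * n) → QOp 2 n) (O : QOp 2 n) : ℝ :=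
  -∑ S : Finset (Fin (2 * n)), pdistG n γ O S * Real.logb 2 (pdistG n γ O S)

/-- Gaussian circuit sensitivity `CiS^G[U] = sup { |I^G[UOU†] - I^G[O]| : ‖O‖₂ = 1 }`. -/
def CiSG (n : ℕ) (γ : Fin (2 * n) → QOp 2 n) (U : QOp 2 n) : ℝ :=
  sSup {x : ℝ | ∃ O : QOp 2 n, l2norm 2 n O = 1 ∧
    x = |influenceG n γ (U * O * Uᴴ) - influenceG n γ O|}

/-- Fourier coefficient `f̂(S)` of a Boolean function `f : {-1,1}^n → ℝ`, with
the domain encoded as `Fin n → Bool` (`true ↦ -1`, `false ↦ 1`). -/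
def fourierCoeff (n : ℕ) (f : (Fin n → Bool) → ℝ) (S : Finset (Fin n)) : ℝ :=
  (∑ x : Fin n → Bool, f x * ∏ i ∈ S, (if x i then -1 else 1)) / 2 ^ n

/-- Fourier entropy of a Boolean function. -/
def boolEntropy (n : ℕ) (f : (Fin n → Bool) → ℝ) : ℝ :=
  -∑ S : Finset (Fin n), (fourierCoeff n f S) ^ 2 * Real.logb 2 ((fourierCoeff n f S) ^ 2)

/-- Total influence of a Boolean function. -/
def boolInfluence (n : ℕ) (f : (Fin n → Bool) → ℝ) : ℝ :=
  ∑ S : Finset (Fin n), (S.card : ℝ) * (fourierCoeff n f S) ^ 2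

/-- The completely dephasing channel `Δ`. -/
def dephase (d n : ℕ) (A : QOp d n) : QOp d n :=
  Matrix.diagonal (fun i => A i i)

/-- The diagonal matrix `log₂ Δ(ρ)` (entrywise base-2 logarithm of the diagonal). -/
def logDephase (d n : ℕ) (A : QOp d n) : QOp d n :=
  Matrix.diagonal (fun i => (Real.logb 2 (A i i).re : ℂ))

/-- The coherence rate `R_C(H,ρ) = -i Tr([ρ, log Δ(ρ)] H)`. -/
def cohRate (d n : ℕ) (H ρ : QOp d n) : ℂ :=
  -Complex.I * ((ρ * logDephase d n ρ - logDephase d n ρ * ρ) * H).trace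

/-- The max-relative entropy `D_max(ρ‖σ) = log₂ min{λ > 0 : ρ ≤ λσ}`. -/
def Dmax (d n : ℕ) (ρ σ : QOp d n) : ℝ :=
  Real.logb 2 (sInf {l : ℝ | 0 < l ∧ ((l : ℂ) • σ - ρ).PosSemidef})

section

variable {d n : ℕ}

lemma embedAt_mul_apply (j : Fin n) (A : Matrix (Fin d) (Fin d) ℂ) (M : QOp d n)
    (x y : Fin n → Fin d) :
    (embedAt d n j A * M) x y = ∑ c, A (x j) c * M (Function.update x j c) y := by
  rw [Matrix.mul_apply]
  symm
  refine Finset.sum_of_injOn (fun c => Function.update x j c) ?_ ?_ ?_ ?_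
  · exact fun a _ b _ h => Function.update_injective x j h
  · simp
  · intro z _ hz
    rw [embedAt, if_neg, zero_mul]
    intro h
    apply hz
    refine ⟨z j, by simp, ?_⟩
    funext i
    by_cases hi : i = j
    · subst hi; simp
    · simp [hi, h i hi]
  · intro c _
    rw [embedAt, if_pos]
    · simp
    · intro i hi; simp [hi]

lemma mul_embedAt_apply (j : Fin n) (A : Matrix (Fin d) (Fin d) ℂ) (M : QOp d n)
    (x y : Fin n → Fin d) :
    (M * embedAt d n j A) x y = ∑ c, M x (Function.update y j c) * A c (y j) := by
  rw [Matrix.mul_apply]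
  symm
  refine Finset.sum_of_injOn (fun c => Function.update y j c) ?_ ?_ ?_ ?_
  · exact fun a _ b _ h => Function.update_injective y j h
  · simp
  · intro z _ hz
    rw [embedAt, if_neg, mul_zero]
    intro h
    apply hz
    refine ⟨z j, by simp, ?_⟩
    funext i
    by_cases hi : i = j
    · subst hi; simp
    · simp [hi, h i hi]
  · intro c _
    rw [embedAt, if_pos]
    · simp
    · intro i hi; simp [hi]

lemma embedAt_one (j : Fin n) : embedAt d n j 1 = 1 := by
  ext x y
  by_cases h : x = y
  · subst h; simp [embedAt]
  · rw [Matrix.one_apply_ne h, embedAt]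
    split_ifs with h'
    · rw [Matrix.one_apply_ne]
      intro hj
      apply h
      funext i
      by_cases hi : i = j
      · exact hi ▸ hj
      · exact h' i hi
    · rfl

lemma embedAt_update_left (j : Fin n) (A : Matrix (Fin d) (Fin d) ℂ) (x y : Fin n → Fin d)
    (c : Fin d) : embedAt d n j A (Function.update x j c) y =
      if ∀ i, i ≠ j → x i = y i then A c (y j) else 0 := by
  rw [embedAt]
  simp only [Function.update_self]
  refine if_congr (forall₂_congr fun i hi => ?_) rfl rfl
  rw [Function.update_of_ne hi]

/-- The embedding of single-qudit operators at site `j`, as a homomorphism of star algebras. -/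
def embedHom (d n : ℕ) (j : Fin n) : Matrix (Fin d) (Fin d) ℂ →⋆ₐ[ℂ] QOp d n where
  toFun := embedAt d n j
  map_one' := embedAt_one j
  map_mul' A B := by
    ext x y
    simp only [embedAt_mul_apply, embedAt_update_left]
    rw [embedAt, Matrix.mul_apply]
    split_ifs <;> simp
  map_zero' := by ext; simp [embedAt]
  map_add' A B := by
    ext x y
    simp only [embedAt, Matrix.add_apply]
    split_ifs <;> simp
  commutes' r := by
    have h : embedAt d n j (r • (1 : Matrix (Fin d) (Fin d) ℂ))
        = r • embedAt d n j (1 : Matrix (Fin d) (Fin d) ℂ) := by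
      ext x y
      simp only [embedAt, Matrix.smul_apply]
      split_ifs <;> simp
    rw [Algebra.algebraMap_eq_smul_one, Algebra.algebraMap_eq_smul_one, h, embedAt_one]
  map_star' A := by
    ext x y
    simp only [embedAt, Matrix.star_eq_conjTranspose, Matrix.conjTranspose_apply, eq_comm]
    split_ifs <;> simp

lemma embedHom_apply (j : Fin n) (A : Matrix (Fin d) (Fin d) ℂ) :
    embedHom d n j A = embedAt d n j A := rfl

lemma embedHom_injective [NeZero d] (j : Fin n) : Function.Injective (embedHom d n j) := by
  intro A B h
  ext a b
  have := congrFun (congrFun h (Function.update 0 j a)) (Function.update 0 j b)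
  simp only [embedHom_apply, embedAt, Function.update_self] at this
  rwa [if_pos, if_pos] at this <;>
  · intro i hi
    simp [Function.update_of_ne hi]

/-- Operators at different sites, multiplied, have product entries. -/
lemma embedAt_mul_embedAt_apply {i j : Fin n} (hij : i ≠ j) (A B : Matrix (Fin d) (Fin d) ℂ)
    (x y : Fin n → Fin d) : (embedAt d n i A * embedAt d n j B) x y =
      if ∀ k, k ≠ i → k ≠ j → x k = y k then A (x i) (y i) * B (x j) (y j) else 0 := by
  rw [embedAt_mul_apply, Finset.sum_eq_single (y i)]
  · rw [embedAt, Function.update_of_ne hij.symm, mul_ite, mul_zero]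
    refine if_congr ⟨fun h k hi hj => ?_, fun h k hj => ?_⟩ rfl rfl
    · simpa [hi] using h k hj
    · by_cases hi : k = i
      · subst hi; simp
      · simpa [hi] using h k hi hj
  · intro c _ hc
    rw [embedAt, if_neg, mul_zero]
    intro h
    exact hc (by simpa using h i hij)
  · simp

lemma commute_embedHom {i j : Fin n} (hij : i ≠ j) (A B : Matrix (Fin d) (Fin d) ℂ) :
    Commute (embedHom d n i A) (embedHom d n j B) := by
  ext x y
  rw [embedHom_apply, embedHom_apply, embedAt_mul_embedAt_apply hij,
    embedAt_mul_embedAt_apply hij.symm]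
  refine if_congr ⟨fun h k hi hj => h k hj hi, fun h k hi hj => h k hj hi⟩ (mul_comm _ _) rfl

lemma embedHom_mul_embedHom_eq_zero [NeZero d] {i j : Fin n} (hij : i ≠ j)
    {A B : Matrix (Fin d) (Fin d) ℂ} (h : embedHom d n i A * embedHom d n j B = 0) :
    A = 0 ∨ B = 0 := by
  by_contra! hAB
  obtain ⟨hA, hB⟩ := hAB
  obtain ⟨a, b, hab⟩ : ∃ a b, A a b ≠ 0 := by
    by_contra! h'
    exact hA (Matrix.ext h')
  obtain ⟨a', b', hab'⟩ : ∃ a b, B a b ≠ 0 := by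
    by_contra! h'
    exact hB (Matrix.ext h')
  have := congrFun (congrFun h (Function.update (Function.update 0 i a) j a'))
    (Function.update (Function.update 0 i b) j b')
  rw [embedHom_apply, embedHom_apply, embedAt_mul_embedAt_apply hij, if_pos] at this
  · simp [hij, hab, hab'] at this
  · intro k hi hj
    simp [hi, hj]

lemma apply_eq_zero_of_commute {M : QOp d n} {j : Fin n}
    (hM : ∀ A, Commute M (embedHom d n j A)) {x y : Fin n → Fin d} (h : x j ≠ y j) :
    M x y = 0 := by
  have := congrFun (congrFun (hM (Matrix.single (x j) (x j) 1)) x) y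
  rw [embedHom_apply, embedAt_mul_apply, mul_embedAt_apply] at this
  simpa [Matrix.single_apply, h] using this.symm

lemma apply_update_of_commute {M : QOp d n} {j : Fin n}
    (hM : ∀ A, Commute M (embedHom d n j A)) {x y : Fin n → Fin d} (h : x j = y j) (c : Fin d) :
    M (Function.update x j c) (Function.update y j c) = M x y := by
  have := congrFun (congrFun (hM (Matrix.single (x j) c 1)) x) (Function.update y j c)
  rw [embedHom_apply, embedAt_mul_apply, mul_embedAt_apply] at this
  simp only [Matrix.single_apply, Function.update_self, Function.update_idem] at this
  simp only [true_and, and_true, mul_ite, mul_one, mul_zero, ite_mul, one_mul, zero_mul,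
    Finset.sum_ite_eq, Finset.mem_univ, if_true] at this
  rw [← this, h, Function.update_eq_self]

lemma exists_embedHom_of_commute [NeZero d] {M : QOp d n} (k : Fin n)
    (hM : ∀ j, j ≠ k → ∀ A, Commute M (embedHom d n j A)) : ∃ B, M = embedHom d n k B := by
  refine ⟨Matrix.of fun a b => M (Function.update 0 k a) (Function.update 0 k b), ?_⟩
  ext x y
  rw [embedHom_apply, embedAt, Matrix.of_apply]
  split_ifs with h
  · have key : ∀ S : Finset (Fin n), k ∉ S → M (S.piecewise 0 x) (S.piecewise 0 y) = M x y := by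
      intro S
      induction S using Finset.induction_on with
      | empty => simp
      | insert j S hj ih =>
        intro hk
        simp only [Finset.mem_insert, not_or] at hk
        rw [Finset.piecewise_insert, Finset.piecewise_insert, Pi.zero_apply,
          apply_update_of_commute (hM j (Ne.symm hk.1)), ih hk.2]
        simp [hj, h j (Ne.symm hk.1)]
    rw [← key (Finset.univ.erase k) (by simp)]
    congr 1 <;>
    · funext i
      by_cases hi : i = k
      · subst hi; simp
      · simp [hi]
  · push Not at h
    obtain ⟨j, hj, hxy⟩ := h
    exact apply_eq_zero_of_commute (hM j hj) hxy

lemma shiftX_pow_apply [NeZero d] (k : ℕ) (i j : Fin d) :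
    (shiftX d ^ k) i j = if (i : ℕ) = ((j : ℕ) + k) % d then 1 else 0 := by
  induction k generalizing j with
  | zero =>
    simp [Matrix.one_apply, Nat.mod_eq_of_lt j.isLt, Fin.ext_iff]
  | succ k ih =>
    rw [pow_succ, Matrix.mul_apply]
    simp only [ih, shiftX]
    have hlt : ((j : ℕ) + 1) % d < d := Nat.mod_lt _ (NeZero.pos d)
    rw [Finset.sum_eq_single (⟨((j : ℕ) + 1) % d, hlt⟩ : Fin d)]
    · simp [add_assoc, add_comm 1 k]
    · intro b _ hb
      rw [if_neg (fun h => hb (Fin.ext h)), mul_zero]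
    · simp

lemma pauli1_apply [NeZero d] (a : ZMod d × ZMod d) (x y : Fin d) :
    pauli1 d a x y = (if (x : ℕ) = ((y : ℕ) + a.1.val) % d then 1 else 0) *
      (Complex.exp (2 * Real.pi * Complex.I / d) ^ (y : ℕ)) ^ a.2.val := by
  rw [pauli1, clockZ, Matrix.diagonal_pow, Matrix.mul_diagonal, shiftX_pow_apply, Pi.pow_apply]
  simp only [← Complex.exp_nat_mul]
  congr 2
  ring

lemma pauli1_zero : pauli1 d 0 = 1 := by simp [pauli1]

lemma sum_zmod_val [NeZero d] {M : Type*} [AddCommMonoid M] (f : ℕ → M) :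
    ∑ t : ZMod d, f t.val = ∑ k ∈ Finset.range d, f k := by
  obtain _ | d := d
  · exact absurd rfl (NeZero.ne 0)
  · exact Fin.sum_univ_eq_sum_range f (d + 1)

lemma sum_phase [NeZero d] (y y' : Fin d) :
    ∑ t : ZMod d, (Complex.exp (2 * Real.pi * Complex.I / d) ^ (y : ℕ)) ^ t.val *
      star ((Complex.exp (2 * Real.pi * Complex.I / d) ^ (y' : ℕ)) ^ t.val) =
      if y = y' then (d : ℂ) else 0 := by
  have hζ := Complex.isPrimitiveRoot_exp d (NeZero.ne d)
  set ζ := Complex.exp (2 * Real.pi * Complex.I / d)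
  have hstar : star ζ = ζ⁻¹ := by
    rw [Complex.star_def, Complex.inv_eq_conj (hζ.norm'_eq_one (NeZero.ne d))]
  have h0 : ζ ≠ 0 := hζ.ne_zero (NeZero.ne d)
  have h1 : ∀ t : ZMod d, (ζ ^ (y : ℕ)) ^ t.val * star ((ζ ^ (y' : ℕ)) ^ t.val) =
      (ζ ^ (y : ℕ) * (ζ ^ (y' : ℕ))⁻¹) ^ t.val := by
    intro t
    rw [star_pow, star_pow, hstar, mul_pow, inv_pow]
  simp_rw [h1]
  rw [sum_zmod_val (fun k => (ζ ^ (y : ℕ) * (ζ ^ (y' : ℕ))⁻¹) ^ k)]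
  split_ifs with h
  · subst h
    simp [h0]
  · have hne : ζ ^ (y : ℕ) * (ζ ^ (y' : ℕ))⁻¹ ≠ 1 := by
      rw [Ne, mul_inv_eq_one₀ (pow_ne_zero _ h0)]
      exact fun h' => h (Fin.ext (hζ.pow_inj y.isLt y'.isLt h'))
    have hone : ∀ k : ℕ, (ζ ^ k) ^ d = 1 := fun k => by
      rw [pow_right_comm, hζ.pow_eq_one, one_pow]
    rw [geom_sum_eq hne, mul_pow, inv_pow, hone, hone]
    simp

lemma sum_shift [NeZero d] (x x' y : Fin d) :
    ∑ s : ZMod d, ((if (x : ℕ) = ((y : ℕ) + s.val) % d then (1 : ℂ) else 0) *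
      (if (x' : ℕ) = ((y : ℕ) + s.val) % d then (1 : ℂ) else 0)) =
      if x = x' then 1 else 0 := by
  have h : ∀ (z : Fin d) (s : ZMod d), (z : ℕ) = ((y : ℕ) + s.val) % d ↔
      s = ((z : ℕ) : ZMod d) - ((y : ℕ) : ZMod d) := by
    intro z s
    rw [eq_sub_iff_add_eq, add_comm s, ← ZMod.natCast_zmod_val s, ← Nat.cast_add,
      ZMod.natCast_eq_natCast_iff', Nat.mod_eq_of_lt z.isLt, ZMod.natCast_zmod_val, eq_comm]
  have heq : ((x' : ℕ) : ZMod d) = ((x : ℕ) : ZMod d) ↔ x = x' := by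
    rw [ZMod.natCast_eq_natCast_iff', Nat.mod_eq_of_lt x.isLt,
      Nat.mod_eq_of_lt x'.isLt, Fin.ext_iff, eq_comm]
  simp_rw [h]
  simp [heq]

/-- The completeness relation of the single-qudit Pauli operators. -/
lemma sum_pauli1_mul_star [NeZero d] (x y x' y' : Fin d) :
    ∑ a : ZMod d × ZMod d, pauli1 d a x y * star (pauli1 d a x' y') =
      if x = x' ∧ y = y' then (d : ℂ) else 0 := by
  simp_rw [pauli1_apply, Fintype.sum_prod_type]
  have : ∀ s t : ZMod d, (if (x : ℕ) = ((y : ℕ) + s.val) % d then (1 : ℂ) else 0) *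
      (Complex.exp (2 * Real.pi * Complex.I / d) ^ (y : ℕ)) ^ t.val *
      star ((if (x' : ℕ) = ((y' : ℕ) + s.val) % d then (1 : ℂ) else 0) *
      (Complex.exp (2 * Real.pi * Complex.I / d) ^ (y' : ℕ)) ^ t.val) =
      ((if (x : ℕ) = ((y : ℕ) + s.val) % d then (1 : ℂ) else 0) *
        (if (x' : ℕ) = ((y' : ℕ) + s.val) % d then (1 : ℂ) else 0)) *
      ((Complex.exp (2 * Real.pi * Complex.I / d) ^ (y : ℕ)) ^ t.val *
        star ((Complex.exp (2 * Real.pi * Complex.I / d) ^ (y' : ℕ)) ^ t.val)) := by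
    intro s t
    rw [star_mul']
    have : star (if (x' : ℕ) = ((y' : ℕ) + s.val) % d then (1 : ℂ) else 0) =
        if (x' : ℕ) = ((y' : ℕ) + s.val) % d then (1 : ℂ) else 0 := by
      split_ifs <;> simp
    rw [this]
    ring
  simp_rw [this, ← Finset.mul_sum, sum_phase]
  by_cases hy : y = y'
  · subst hy
    simp only [and_true, if_true, ← Finset.sum_mul, sum_shift]
    simp
  · simp [hy]

lemma trace_pauli1_eq_zero [NeZero d] {a : ZMod d × ZMod d} (ha : a ≠ 0) :
    (pauli1 d a).trace = 0 := by
  have hsum : ∑ b : ZMod d × ZMod d, (pauli1 d b).trace * star (pauli1 d b).trace =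
      (d : ℂ) * d := by
    simp_rw [Matrix.trace, Matrix.diag, star_sum, Finset.sum_mul_sum]
    rw [Finset.sum_comm]
    simp_rw [Finset.sum_comm (s := (Finset.univ : Finset (ZMod d × ZMod d))),
      sum_pauli1_mul_star]
    simp
  rw [← Finset.add_sum_erase _ _ (Finset.mem_univ 0), pauli1_zero] at hsum
  have h0 : ∑ b ∈ Finset.univ.erase (0 : ZMod d × ZMod d),
      ‖(pauli1 d b).trace‖ ^ 2 = 0 := by
    simp only [Matrix.trace_one, Fintype.card_fin, star_natCast, add_eq_left] at hsum
    have : ∀ z : ℂ, z * star z = ((‖z‖ ^ 2 : ℝ) : ℂ) := by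
      intro z; rw [Complex.star_def, Complex.mul_conj']; push_cast; rfl
    simp_rw [this] at hsum
    exact_mod_cast hsum
  rw [Finset.sum_eq_zero_iff_of_nonneg (fun _ _ => by positivity)] at h0
  simpa using h0 a (by simpa using ha)

/-- The completeness relation of the Pauli operators. -/
lemma sum_pauliN_mul_star [NeZero d] (x y x' y' : Fin n → Fin d) :
    ∑ a : Fin n → ZMod d × ZMod d, pauliN d n a x y * star (pauliN d n a x' y') =
      if x = x' ∧ y = y' then (d : ℂ) ^ n else 0 := by
  simp_rw [pauliN, star_prod, ← Finset.prod_mul_distrib]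
  rw [← Fintype.prod_sum (fun i b => pauli1 d b (x i) (y i) * star (pauli1 d b (x' i) (y' i)))]
  simp_rw [sum_pauli1_mul_star]
  split_ifs with h
  · obtain ⟨rfl, rfl⟩ := h
    simp
  · have : ∃ i, ¬ (x i = x' i ∧ y i = y' i) := by
      by_contra! h'
      exact h ⟨funext fun i => (h' i).1, funext fun i => (h' i).2⟩
    obtain ⟨i, hi⟩ := this
    exact Finset.prod_eq_zero (Finset.mem_univ i) (if_neg hi)

lemma pauliN_zero : pauliN d n 0 = 1 := by
  ext x y
  simp only [pauliN, Pi.zero_apply, pauli1_zero, Matrix.one_apply]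
  rw [Finset.prod_ite_zero]
  simp [funext_iff]

/-- A Pauli operator splits into its factor at site `j` and the remaining factors. -/
lemma embedHom_mul_pauliN_update (j : Fin n) (a : Fin n → ZMod d × ZMod d) :
    embedHom d n j (pauli1 d (a j)) * pauliN d n (Function.update a j 0) = pauliN d n a := by
  ext x y
  rw [embedHom_apply, embedAt_mul_apply, Finset.sum_eq_single (y j)]
  · simp only [pauliN]
    rw [← Finset.mul_prod_erase _ _ (Finset.mem_univ j),
      ← Finset.mul_prod_erase _ (fun i => pauli1 d (a i) (x i) (y i)) (Finset.mem_univ j)]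
    simp only [Function.update_self, pauli1_zero, Matrix.one_apply_eq, one_mul]
    congr 1
    refine Finset.prod_congr rfl fun i hi => ?_
    rw [Function.update_of_ne (Finset.ne_of_mem_erase hi),
      Function.update_of_ne (Finset.ne_of_mem_erase hi)]
  · intro c _ hc
    rw [pauliN, Finset.prod_eq_zero (Finset.mem_univ j), mul_zero]
    simp [pauli1_zero, hc]
  · simp

lemma commute_pauliN_embedHom {j : Fin n} {a : Fin n → ZMod d × ZMod d} (ha : a j = 0)
    (A : Matrix (Fin d) (Fin d) ℂ) : Commute (pauliN d n a) (embedHom d n j A) := by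
  have key : ∀ x y c, pauliN d n a x (Function.update y j c) =
      if x j = c then ∏ i ∈ Finset.univ.erase j, pauli1 d (a i) (x i) (y i) else 0 := by
    intro x y c
    rw [pauliN, ← Finset.mul_prod_erase _ _ (Finset.mem_univ j), ha, pauli1_zero,
      Function.update_self, Matrix.one_apply, ite_mul, one_mul, zero_mul]
    refine if_congr Iff.rfl (Finset.prod_congr rfl fun i hi => ?_) rfl
    rw [Function.update_of_ne (Finset.ne_of_mem_erase hi)]
  have key' : ∀ x y c, pauliN d n a (Function.update x j c) y =
      if c = y j then ∏ i ∈ Finset.univ.erase j, pauli1 d (a i) (x i) (y i) else 0 := by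
    intro x y c
    rw [pauliN, ← Finset.mul_prod_erase _ _ (Finset.mem_univ j), ha, pauli1_zero,
      Function.update_self, Matrix.one_apply, ite_mul, one_mul, zero_mul]
    refine if_congr Iff.rfl (Finset.prod_congr rfl fun i hi => ?_) rfl
    rw [Function.update_of_ne (Finset.ne_of_mem_erase hi)]
  ext x y
  rw [embedHom_apply, embedAt_mul_apply, mul_embedAt_apply]
  simp [key, key', mul_comm]

/-- Expansion of an operator in the Pauli basis. -/
lemma pauli_expansion [NeZero d] (M : QOp d n) :
    ∑ a, (M * pauliN d n a).trace • (pauliN d n a)ᴴ = (d : ℂ) ^ n • M := by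
  ext x y
  rw [Matrix.sum_apply]
  simp only [Matrix.smul_apply, smul_eq_mul, Matrix.trace, Matrix.diag, Matrix.mul_apply,
    Matrix.conjTranspose_apply, Finset.sum_mul, mul_assoc]
  rw [Finset.sum_comm]
  simp_rw [Finset.sum_comm (s := (Finset.univ : Finset (Fin n → ZMod d × ZMod d))),
    ← Finset.mul_sum, sum_pauliN_mul_star, ite_and]
  simp [mul_comm]

/-- A tracial functional on a full matrix algebra vanishes on traceless matrices. -/
lemma tracial_apply_eq_zero [NeZero d] (f : Matrix (Fin d) (Fin d) ℂ →ₗ[ℂ] ℂ)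
    (hf : ∀ A B, f (A * B) = f (B * A)) {A : Matrix (Fin d) (Fin d) ℂ} (hA : A.trace = 0) :
    f A = 0 := by
  have h : ∀ i j c, f (Matrix.single i j c) =
      if i = j then c * f (Matrix.single 0 0 1) else 0 := by
    intro i j c
    split_ifs with hij
    · subst hij
      have := hf (Matrix.single i 0 c) (Matrix.single 0 i 1)
      rw [Matrix.single_mul_single_same, Matrix.single_mul_single_same, mul_one, one_mul] at this
      rw [this, ← smul_eq_mul, ← map_smul, Matrix.smul_single, smul_eq_mul, mul_one]
    · have := hf (Matrix.single i i 1) (Matrix.single i j c)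
      rwa [Matrix.single_mul_single_same, Matrix.single_mul_single_of_ne _ _ _ _ (Ne.symm hij),
        map_zero, one_mul] at this
  have hrow : ∀ i, f (∑ j, Matrix.single i j (A i j)) = A i i * f (Matrix.single 0 0 1) := by
    intro i
    rw [map_sum, Finset.sum_congr rfl fun j _ => h i j (A i j)]
    simp
  rw [Matrix.matrix_eq_sum_single A, map_sum, Finset.sum_congr rfl fun i _ => hrow i,
    ← Finset.sum_mul]
  have : ∑ i, A i i = 0 := hA
  rw [this, zero_mul]

lemma trace_embedHom_eq_zero [NeZero d] (j : Fin n) {A : Matrix (Fin d) (Fin d) ℂ}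
    (hA : A.trace = 0) : (embedHom d n j A).trace = 0 :=
  tracial_apply_eq_zero
    ((Matrix.traceLinearMap (Fin n → Fin d) ℂ ℂ).comp (embedHom d n j).toAlgHom.toLinearMap)
    (fun A B => by
      change (embedHom d n j (A * B)).trace = (embedHom d n j (B * A)).trace
      rw [map_mul, map_mul, Matrix.trace_mul_comm]) hA

lemma trace_mul_pauliN_eq_zero [NeZero d] {M : QOp d n} {j : Fin n}
    (hM : ∀ A, Commute M (embedHom d n j A)) {a : Fin n → ZMod d × ZMod d} (ha : a j ≠ 0) :
    (M * pauliN d n a).trace = 0 := by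
  rw [← embedHom_mul_pauliN_update j a]
  have hP := commute_pauliN_embedHom (d := d) (n := n) (j := j) (a := Function.update a j 0)
    (by simp)
  refine tracial_apply_eq_zero
    ((Matrix.traceLinearMap (Fin n → Fin d) ℂ ℂ).comp ((LinearMap.mulLeft ℂ M).comp
      ((LinearMap.mulRight ℂ (pauliN d n (Function.update a j 0))).comp
        (embedHom d n j).toAlgHom.toLinearMap))) (fun A B => ?_) (trace_pauli1_eq_zero ha)
  change (M * (embedHom d n j (A * B) * _)).trace = (M * (embedHom d n j (B * A) * _)).trace
  rw [map_mul, map_mul, mul_assoc _ (embedHom d n j B), ← (hP B).eq, ← mul_assoc, ← mul_assoc,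
    Matrix.trace_mul_comm, ← mul_assoc, ← mul_assoc, ← (hM B).eq]
  simp only [mul_assoc]

lemma trace_conjTranspose_mul_sum (s : Finset (Fin n → ZMod d × ZMod d)) (B M : QOp d n) :
    (Bᴴ * ∑ a ∈ s, (M * pauliN d n a).trace • (pauliN d n a)ᴴ).trace =
      ∑ a ∈ s, (M * pauliN d n a).trace * star (B * pauliN d n a).trace := by
  rw [Finset.mul_sum, Matrix.trace_sum]
  refine Finset.sum_congr rfl fun a _ => ?_
  rw [Matrix.mul_smul, Matrix.trace_smul, smul_eq_mul, ← Matrix.conjTranspose_mul,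
    Matrix.trace_conjTranspose, Matrix.trace_mul_comm B]

lemma mul_star_eq_norm_sq (z : ℂ) : z * star z = ((‖z‖ ^ 2 : ℝ) : ℂ) := by
  rw [Complex.star_def, Complex.mul_conj']
  push_cast
  rfl

/-- The squared normalized 2-norm. -/
def sqNorm (d n : ℕ) (O : QOp d n) : ℝ := ((Oᴴ * O).trace).re / (d : ℝ) ^ n

/-- Parseval's identity for the Pauli basis. -/
lemma sum_pdist [NeZero d] (O : QOp d n) : ∑ a, pdist d n O a = sqNorm d n O := by
  have hd : (d : ℝ) ≠ 0 := Nat.cast_ne_zero.mpr (NeZero.ne d)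
  have h := trace_conjTranspose_mul_sum Finset.univ O O
  rw [pauli_expansion, Matrix.mul_smul, Matrix.trace_smul, smul_eq_mul] at h
  simp_rw [mul_star_eq_norm_sq] at h
  have h' : (d : ℝ) ^ n * ((Oᴴ * O).trace).re = ∑ a, ‖(O * pauliN d n a).trace‖ ^ 2 := by
    have := congrArg Complex.re h
    rw [← Complex.ofReal_sum, Complex.ofReal_re, ← Complex.ofReal_natCast, ← Complex.ofReal_pow,
      Complex.re_ofReal_mul] at this
    exact this
  simp_rw [pdist, sqNorm]
  rw [← Finset.sum_div, ← h', two_mul, pow_add]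
  field_simp

lemma pdist_nonneg (O : QOp d n) (a : Fin n → ZMod d × ZMod d) : 0 ≤ pdist d n O a := by
  unfold pdist
  positivity

lemma sqNorm_nonneg [NeZero d] (O : QOp d n) : 0 ≤ sqNorm d n O := by
  rw [← sum_pdist]
  exact Finset.sum_nonneg fun a _ => pdist_nonneg O a

lemma l2norm_eq_one_iff (O : QOp d n) : l2norm d n O = 1 ↔ sqNorm d n O = 1 := by
  rw [l2norm, Real.sqrt_eq_one, sqNorm]

lemma pdist_congr {O M : QOp d n} {a : Fin n → ZMod d × ZMod d}
    (h : (M * pauliN d n a).trace = 0) : pdist d n (O - M) a = pdist d n O a := by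
  rw [pdist, pdist, Matrix.sub_mul, Matrix.trace_sub, h, sub_zero]

/-- The local influence is at most the squared distance to any operator commuting with all
operators at the given site. -/
lemma localInfluence_le_sqNorm_sub [NeZero d] (j : Fin n) (O : QOp d n) {M : QOp d n}
    (hM : ∀ A, Commute M (embedHom d n j A)) :
    localInfluence d n j O ≤ sqNorm d n (O - M) := by
  rw [localInfluence, ← sum_pdist]
  calc _ = ∑ a ∈ Finset.univ.filter (fun a : Fin n → ZMod d × ZMod d => a j ≠ 0),
        pdist d n (O - M) a := by
        refine Finset.sum_congr rfl fun a ha => ?_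
        rw [pdist_congr (trace_mul_pauliN_eq_zero hM (by simpa using ha))]
    _ ≤ _ := Finset.sum_le_sum_of_subset_of_nonneg (Finset.filter_subset _ _)
        fun a _ _ => pdist_nonneg _ a

lemma commute_conjTranspose_pauliN_embedHom {j : Fin n} {a : Fin n → ZMod d × ZMod d}
    (ha : a j = 0) (A : Matrix (Fin d) (Fin d) ℂ) :
    Commute (pauliN d n a)ᴴ (embedHom d n j A) := by
  have := (commute_pauliN_embedHom ha (star A)).star_star
  rwa [← map_star, star_star] at this

lemma exists_localInfluence_eq_sqNorm_sub [NeZero d] (j : Fin n) (O : QOp d n) :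
    ∃ M : QOp d n, (∀ A, Commute M (embedHom d n j A)) ∧
      localInfluence d n j O = sqNorm d n (O - M) := by
  have hd : (d : ℝ) ≠ 0 := Nat.cast_ne_zero.mpr (NeZero.ne d)
  have hd' : (d : ℂ) ^ n ≠ 0 := pow_ne_zero _ (Nat.cast_ne_zero.mpr (NeZero.ne d))
  set s := Finset.univ.filter (fun a : Fin n → ZMod d × ZMod d => a j ≠ 0) with hs
  set t := Finset.univ.filter (fun a : Fin n → ZMod d × ZMod d => ¬ a j ≠ 0) with ht
  set M : QOp d n := ((d : ℂ) ^ n)⁻¹ • ∑ a ∈ t, (O * pauliN d n a).trace • (pauliN d n a)ᴴ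
    with hMdef
  have hM : ∀ A, Commute M (embedHom d n j A) := by
    intro A
    refine Commute.smul_left (Commute.sum_left _ _ _ fun a ha => ?_) _
    exact (commute_conjTranspose_pauliN_embedHom (by simpa [ht] using ha) A).smul_left _
  have hR : O - M =
      ((d : ℂ) ^ n)⁻¹ • ∑ a ∈ s, (O * pauliN d n a).trace • (pauliN d n a)ᴴ := by
    rw [sub_eq_iff_eq_add, hMdef, ← smul_add, hs, ht, Finset.sum_filter_add_sum_filter_not,
      pauli_expansion, inv_smul_smul₀ hd']
  refine ⟨M, hM, ?_⟩
  have h : ((O - M)ᴴ * (O - M)).trace =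
      (((∑ a ∈ s, ‖(O * pauliN d n a).trace‖ ^ 2) / (d : ℝ) ^ n : ℝ) : ℂ) := by
    nth_rewrite 2 [hR]
    rw [Matrix.mul_smul, Matrix.trace_smul, trace_conjTranspose_mul_sum, smul_eq_mul,
      div_eq_inv_mul]
    push_cast
    congr 1
    refine Finset.sum_congr rfl fun a ha => ?_
    rw [Matrix.sub_mul, Matrix.trace_sub, trace_mul_pauliN_eq_zero hM (by simpa [hs] using ha),
      sub_zero, mul_star_eq_norm_sq]
    push_cast
    rfl
  rw [sqNorm, h, Complex.ofReal_re, localInfluence, ← hs]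
  simp_rw [pdist]
  rw [← Finset.sum_div, two_mul, pow_add, div_div]

lemma influence_eq_sum_localInfluence [NeZero d] (O : QOp d n) :
    influence d n O = ∑ j, localInfluence d n j O := by
  simp_rw [influence, localInfluence, Finset.sum_filter]
  rw [Finset.sum_comm]
  refine Finset.sum_congr rfl fun a _ => ?_
  rw [← Finset.sum_filter, Finset.sum_const, nsmul_eq_mul, weight]

lemma influence_nonneg [NeZero d] (O : QOp d n) : 0 ≤ influence d n O :=
  Finset.sum_nonneg fun a _ => mul_nonneg (Nat.cast_nonneg _) (pdist_nonneg O a)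

lemma influence_le [NeZero d] (O : QOp d n) : influence d n O ≤ n * sqNorm d n O := by
  rw [influence, ← sum_pdist, Finset.mul_sum]
  refine Finset.sum_le_sum fun a _ => mul_le_mul_of_nonneg_right ?_ (pdist_nonneg O a)
  rw [weight]
  exact_mod_cast (Finset.card_filter_le _ _).trans_eq (by simp)

lemma pdist_smul (c : ℂ) (O : QOp d n) (a : Fin n → ZMod d × ZMod d) :
    pdist d n (c • O) a = ‖c‖ ^ 2 * pdist d n O a := by
  rw [pdist, pdist, Matrix.smul_mul, Matrix.trace_smul, smul_eq_mul, norm_mul, mul_pow,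
    mul_div_assoc]

lemma influence_smul [NeZero d] (c : ℂ) (O : QOp d n) :
    influence d n (c • O) = ‖c‖ ^ 2 * influence d n O := by
  simp_rw [influence, pdist_smul, Finset.mul_sum]
  exact Finset.sum_congr rfl fun a _ => by ring

lemma sqNorm_smul [NeZero d] (c : ℂ) (O : QOp d n) :
    sqNorm d n (c • O) = ‖c‖ ^ 2 * sqNorm d n O := by
  simp_rw [← sum_pdist, pdist_smul, Finset.mul_sum]

lemma eq_zero_of_sqNorm_eq_zero [NeZero d] {O : QOp d n} (h : sqNorm d n O = 0) : O = 0 := by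
  rw [← sum_pdist, Finset.sum_eq_zero_iff_of_nonneg (fun a _ => pdist_nonneg O a)] at h
  have hd' : (d : ℂ) ^ n ≠ 0 := pow_ne_zero _ (Nat.cast_ne_zero.mpr (NeZero.ne d))
  have hexp := pauli_expansion O
  rw [Finset.sum_eq_zero] at hexp
  · exact ((smul_eq_zero.mp hexp.symm).resolve_left hd')
  · intro a ha
    have := h a ha
    rw [pdist, div_eq_zero_iff] at this
    have hd : (d : ℝ) ^ (2 * n) ≠ 0 := pow_ne_zero _ (Nat.cast_ne_zero.mpr (NeZero.ne d))
    have h0 := this.resolve_right hd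
    rw [norm_eq_zero.mp (pow_eq_zero_iff two_ne_zero |>.mp h0), zero_smul]

/-- Conjugation by a unitary, as a star algebra automorphism. -/
abbrev conjBy (U : Matrix.unitaryGroup (Fin n → Fin d) ℂ) : QOp d n ≃⋆ₐ[ℂ] QOp d n :=
  Unitary.conjStarAlgAut ℂ (QOp d n) U

lemma trace_conjBy (U : Matrix.unitaryGroup (Fin n → Fin d) ℂ) (O : QOp d n) :
    (conjBy U O).trace = O.trace := by
  rw [Unitary.conjStarAlgAut_apply, Matrix.trace_mul_comm, ← mul_assoc,
    Unitary.coe_star_mul_self, one_mul]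

lemma sqNorm_conjBy (U : Matrix.unitaryGroup (Fin n → Fin d) ℂ) (O : QOp d n) :
    sqNorm d n (conjBy U O) = sqNorm d n O := by
  rw [sqNorm, sqNorm, ← Matrix.star_eq_conjTranspose, ← Matrix.star_eq_conjTranspose, ← map_star,
    ← map_mul, trace_conjBy]

lemma cis_eq_zero_iff [NeZero d] (U : Matrix.unitaryGroup (Fin n → Fin d) ℂ) :
    CiS d n (U : QOp d n) = 0 ↔ ∀ O, influence d n (conjBy U O) = influence d n O := by
  have hconj : ∀ O, (U : QOp d n) * O * (U : QOp d n)ᴴ = conjBy U O := fun O => rfl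
  rw [CiS]
  simp_rw [hconj, l2norm_eq_one_iff]
  constructor
  · intro h O
    by_cases hO : sqNorm d n O = 0
    · rw [eq_zero_of_sqNorm_eq_zero hO, map_zero]
    have hpos : 0 < sqNorm d n O := lt_of_le_of_ne (sqNorm_nonneg O) (Ne.symm hO)
    set c : ℂ := (((Real.sqrt (sqNorm d n O))⁻¹ : ℝ) : ℂ) with hc
    have hcn : ‖c‖ ^ 2 = (sqNorm d n O)⁻¹ := by
      rw [hc, Complex.norm_real, Real.norm_eq_abs, sq_abs, inv_pow, Real.sq_sqrt hpos.le]
    have hbdd : BddAbove {x : ℝ | ∃ O : QOp d n, sqNorm d n O = 1 ∧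
        x = |influence d n (conjBy U O) - influence d n O|} := by
      refine ⟨n, ?_⟩
      rintro x ⟨O, hO, rfl⟩
      have h1 := influence_le O
      have h2 := influence_le (conjBy U O)
      rw [sqNorm_conjBy] at h2
      rw [hO, mul_one] at h1 h2
      exact abs_sub_le_of_nonneg_of_le (influence_nonneg _) h2 (influence_nonneg _) h1
    have hle := le_csSup hbdd ⟨c • O, by rw [sqNorm_smul, hcn, inv_mul_cancel₀ hO], rfl⟩
    rw [h, map_smul, influence_smul, influence_smul, ← mul_sub] at hle
    have := abs_nonpos_iff.mp hle
    rw [hcn] at this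
    exact sub_eq_zero.mp ((mul_eq_zero.mp this).resolve_left (inv_ne_zero hO))
  · intro h
    refine le_antisymm (Real.sSup_nonpos ?_) (Real.sSup_nonneg ?_)
    · rintro x ⟨O, -, rfl⟩
      rw [h O, sub_self, abs_zero]
    · rintro x ⟨O, -, rfl⟩
      positivity

lemma commute_conjBy (U : Matrix.unitaryGroup (Fin n → Fin d) ℂ) {M N : QOp d n}
    (h : Commute M N) : Commute (conjBy U M) (conjBy U N) := by
  rw [Commute, SemiconjBy, ← map_mul, ← map_mul, h.eq]

/-- A unitary whose conjugation permutes the local operator algebras does not increase the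
influence. -/
lemma influence_conjBy_le [NeZero d] (U : Matrix.unitaryGroup (Fin n → Fin d) ℂ)
    (σ : Equiv.Perm (Fin n))
    (h : ∀ j A, ∃ B, embedHom d n j A = conjBy U (embedHom d n (σ j) B)) (O : QOp d n) :
    influence d n (conjBy U O) ≤ influence d n O := by
  rw [influence_eq_sum_localInfluence, influence_eq_sum_localInfluence,
    ← Equiv.sum_comp σ (fun j => localInfluence d n j O)]
  refine Finset.sum_le_sum fun j _ => ?_
  obtain ⟨M, hM, hOM⟩ := exists_localInfluence_eq_sqNorm_sub (σ j) O
  rw [hOM, ← sqNorm_conjBy U, map_sub]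
  refine localInfluence_le_sqNorm_sub j _ fun A => ?_
  obtain ⟨B, hB⟩ := h j A
  rw [hB]
  exact commute_conjBy U (hM B)

lemma influence_conjBy_embedAt_le [NeZero d] (U : Matrix.unitaryGroup (Fin n → Fin d) ℂ)
    (k : Fin n) (W : Matrix (Fin d) (Fin d) ℂ) (hU : (U : QOp d n) = embedAt d n k W)
    (O : QOp d n) : influence d n (conjBy U O) ≤ influence d n O := by
  refine influence_conjBy_le U 1 (fun j A => ?_) O
  rw [← embedHom_apply] at hU
  by_cases hj : j = k
  · subst hj
    refine ⟨star W * A * W, ?_⟩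
    have h1 : (U : QOp d n) * star (U : QOp d n) = 1 := Unitary.coe_mul_star_self U
    rw [Equiv.Perm.one_apply, Unitary.conjStarAlgAut_apply, map_mul, map_mul, map_star, ← hU,
      mul_assoc, mul_assoc, h1, mul_one, ← mul_assoc, h1, one_mul]
  · refine ⟨A, ?_⟩
    have h1 : (U : QOp d n) * star (U : QOp d n) = 1 := Unitary.coe_mul_star_self U
    rw [Equiv.Perm.one_apply, Unitary.conjStarAlgAut_apply, hU,
      (commute_embedHom (Ne.symm hj) W A).eq, ← hU, mul_assoc, h1, mul_one]

lemma swapOp_mul_apply (i j : Fin n) (M : QOp d n) (x y : Fin n → Fin d) :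
    (swapOp d n i j * M) x y = M (x ∘ Equiv.swap i j) y := by
  have h : ∀ z : Fin n → Fin d, x = z ∘ Equiv.swap i j ↔ x ∘ Equiv.swap i j = z := by
    intro z
    constructor
    · rintro rfl; funext k; simp
    · rintro rfl; funext k; simp
  simp [Matrix.mul_apply, swapOp, h]

lemma mul_swapOp_apply (i j : Fin n) (M : QOp d n) (x y : Fin n → Fin d) :
    (M * swapOp d n i j) x y = M x (y ∘ Equiv.swap i j) := by
  simp [Matrix.mul_apply, swapOp]

lemma star_swapOp (i j : Fin n) : star (swapOp d n i j) = swapOp d n i j := by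
  ext x y
  have h : y = x ∘ Equiv.swap i j ↔ x = y ∘ Equiv.swap i j := by
    constructor
    · rintro rfl; funext k; simp
    · rintro rfl; funext k; simp
  simp only [Matrix.star_eq_conjTranspose, Matrix.conjTranspose_apply, swapOp, h]
  split_ifs <;> simp

lemma swapOp_mul_self (i j : Fin n) : swapOp d n i j * swapOp d n i j = 1 := by
  ext x y
  rw [swapOp_mul_apply, swapOp, Matrix.one_apply]
  refine if_congr ?_ rfl rfl
  constructor
  · intro h
    funext k
    simpa using congrFun h (Equiv.swap i j k)
  · rintro rfl; rfl

lemma swapOp_mul_embedHom (i j k : Fin n) (A : Matrix (Fin d) (Fin d) ℂ) :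
    swapOp d n i j * embedHom d n k A =
      embedHom d n (Equiv.swap i j k) A * swapOp d n i j := by
  ext x y
  rw [swapOp_mul_apply, mul_swapOp_apply, embedHom_apply, embedHom_apply, embedAt, embedAt]
  simp only [Function.comp_apply, Equiv.swap_apply_self]
  refine if_congr ⟨fun h l hl => ?_, fun h l hl => ?_⟩ rfl rfl
  · simpa using h (Equiv.swap i j l) (fun h' => hl (by rw [← h', Equiv.swap_apply_self]))
  · simpa using h (Equiv.swap i j l) (fun heq => hl ((Equiv.swap i j).injective heq))

/-- The swap unitary as an element of the unitary group. -/
def swapUnitary (d n : ℕ) (i j : Fin n) : Matrix.unitaryGroup (Fin n → Fin d) ℂ :=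
  ⟨swapOp d n i j, Matrix.mem_unitaryGroup_iff.mpr (by rw [star_swapOp, swapOp_mul_self])⟩

lemma conjBy_swapUnitary_embedHom (i j k : Fin n) (A : Matrix (Fin d) (Fin d) ℂ) :
    conjBy (swapUnitary d n i j) (embedHom d n k A) = embedHom d n (Equiv.swap i j k) A := by
  rw [Unitary.conjStarAlgAut_apply]
  change swapOp d n i j * _ * star (swapOp d n i j) = _
  rw [swapOp_mul_embedHom, star_swapOp, mul_assoc, swapOp_mul_self, mul_one]

lemma influence_conjBy_swapUnitary_le [NeZero d] (i j : Fin n) (O : QOp d n) :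
    influence d n (conjBy (swapUnitary d n i j) O) ≤ influence d n O := by
  refine influence_conjBy_le _ (Equiv.swap i j) (fun k A => ⟨A, ?_⟩) O
  rw [conjBy_swapUnitary_embedHom, Equiv.swap_apply_self]

/-- The single-qudit unitaries and the swap unitaries. -/
def localGenerators (d n : ℕ) : Set (Matrix.unitaryGroup (Fin n → Fin d) ℂ) :=
  {V | (∃ (j : Fin n) (W : Matrix (Fin d) (Fin d) ℂ),
    W ∈ Matrix.unitaryGroup (Fin d) ℂ ∧ (V : QOp d n) = embedAt d n j W) ∨
    (∃ i j : Fin n, (V : QOp d n) = swapOp d n i j)}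

lemma conjBy_one_apply (O : QOp d n) : conjBy 1 O = O := by
  rw [Unitary.conjStarAlgAut_apply]
  simp

lemma conjBy_inv_conjBy (U : Matrix.unitaryGroup (Fin n → Fin d) ℂ) (O : QOp d n) :
    conjBy U⁻¹ (conjBy U O) = O := by
  rw [← Unitary.conjStarAlgAut_mul_apply, inv_mul_cancel, conjBy_one_apply]

lemma influence_conjBy_of_mem_closure [NeZero d] {U : Matrix.unitaryGroup (Fin n → Fin d) ℂ}
    (hU : U ∈ Subgroup.closure (localGenerators d n)) :
    ∀ O, influence d n (conjBy U O) = influence d n O := by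
  induction hU using Subgroup.closure_induction with
  | mem V hV =>
    intro O
    have hle : ∀ O, influence d n (conjBy V O) ≤ influence d n O := by
      obtain ⟨j, W, -, hW⟩ | ⟨i, j, hS⟩ := hV
      · exact influence_conjBy_embedAt_le V j W hW
      · obtain rfl : V = swapUnitary d n i j := Subtype.ext hS
        exact influence_conjBy_swapUnitary_le i j
    have hle' : ∀ O, influence d n (conjBy V⁻¹ O) ≤ influence d n O := by
      obtain ⟨j, W, -, hW⟩ | ⟨i, j, hS⟩ := hV
      · refine influence_conjBy_embedAt_le V⁻¹ j (star W) ?_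
        rw [← embedHom_apply, map_star, embedHom_apply, ← hW]
        rfl
      · obtain rfl : V = swapUnitary d n i j := Subtype.ext hS
        have : (swapUnitary d n i j)⁻¹ = swapUnitary d n i j :=
          Subtype.ext (star_swapOp i j)
        rw [this]
        exact influence_conjBy_swapUnitary_le i j
    refine le_antisymm (hle O) ?_
    have := hle' (conjBy V O)
    rwa [conjBy_inv_conjBy] at this
  | one =>
    intro O
    rw [conjBy_one_apply]
  | mul V W _ _ hV hW => intro O; rw [Unitary.conjStarAlgAut_mul_apply, hV, hW]
  | inv V _ hV =>
    intro O
    have := conjBy_inv_conjBy V⁻¹ O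
    rw [inv_inv] at this
    rw [← hV, this]

lemma influence_embedHom_eq_sqNorm [NeZero d] (k : Fin n) {A : Matrix (Fin d) (Fin d) ℂ}
    (hA : A.trace = 0) :
    influence d n (embedHom d n k A) = sqNorm d n (embedHom d n k A) := by
  rw [← sum_pdist, influence]
  refine Finset.sum_congr rfl fun a _ => ?_
  by_cases hex : ∃ j, j ≠ k ∧ a j ≠ 0
  · obtain ⟨j, hj, ha⟩ := hex
    have : pdist d n (embedHom d n k A) a = 0 := by
      rw [pdist, trace_mul_pauliN_eq_zero
        (fun B => commute_embedHom (Ne.symm hj) A B) ha]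
      simp
    rw [this, mul_zero]
  · push Not at hex
    by_cases hk : a k = 0
    · have ha : a = 0 := by
        funext j
        by_cases hj : j = k
        · rw [hj, hk]; rfl
        · exact hex j hj
      have : pdist d n (embedHom d n k A) a = 0 := by
        rw [pdist, ha, pauliN_zero, mul_one, trace_embedHom_eq_zero k hA]
        simp
      rw [this, mul_zero]
    · have : Finset.univ.filter (fun i => a i ≠ 0) = {k} := by
        ext j
        simp only [Finset.mem_filter, Finset.mem_univ, true_and, Finset.mem_singleton]
        exact ⟨fun h => by_contra fun hj => h (hex j hj), fun h => h ▸ hk⟩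
      rw [weight, this]
      simp

/-- A traceless operator whose influence equals its squared norm has no Pauli components on two
or more sites, so its iterated commutators with operators at different sites vanish. -/
lemma lie_lie_eq_zero_of_influence_eq [NeZero d] {O : QOp d n} (h0 : O.trace = 0)
    (hO : influence d n O = sqNorm d n O) {i j : Fin n} (hij : i ≠ j)
    (A A' : Matrix (Fin d) (Fin d) ℂ) : ⁅⁅O, embedHom d n i A⁆, embedHom d n j A'⁆ = 0 := by
  have hd' : (d : ℂ) ^ n ≠ 0 := pow_ne_zero _ (Nat.cast_ne_zero.mpr (NeZero.ne d))
  have hd : (d : ℝ) ^ (2 * n) ≠ 0 := pow_ne_zero _ (Nat.cast_ne_zero.mpr (NeZero.ne d))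
  have hp0 : pdist d n O 0 = 0 := by
    rw [pdist, pauliN_zero, mul_one, h0]
    simp
  have hterm : ∀ a : Fin n → ZMod d × ZMod d, 0 ≤ ((weight d n a : ℝ) - 1) * pdist d n O a := by
    intro a
    by_cases ha : a = 0
    · rw [ha, hp0, mul_zero]
    · refine mul_nonneg ?_ (pdist_nonneg O a)
      obtain ⟨l, hl⟩ := Function.ne_iff.mp ha
      have : 1 ≤ weight d n a := Finset.card_pos.mpr ⟨l, by simpa using hl⟩
      rw [sub_nonneg]
      exact_mod_cast this
  have hsum : ∑ a, ((weight d n a : ℝ) - 1) * pdist d n O a = 0 := by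
    simp_rw [sub_mul, one_mul]
    rw [Finset.sum_sub_distrib, sum_pdist, ← hO, influence, sub_self]
  rw [Finset.sum_eq_zero_iff_of_nonneg fun a _ => hterm a] at hsum
  have hzero : ∀ a : Fin n → ZMod d × ZMod d, a i ≠ 0 → a j ≠ 0 →
      (O * pauliN d n a).trace = 0 := by
    intro a hi hj
    have hw : 1 < weight d n a :=
      Finset.one_lt_card.mpr ⟨i, by simpa using hi, j, by simpa using hj, hij⟩
    have hw' : ((weight d n a : ℝ) - 1) ≠ 0 := by
      rw [sub_ne_zero]
      exact_mod_cast hw.ne'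
    have := (mul_eq_zero.mp (hsum a (Finset.mem_univ a))).resolve_left hw'
    rw [pdist, div_eq_zero_iff] at this
    exact norm_eq_zero.mp ((pow_eq_zero_iff two_ne_zero).mp (this.resolve_right hd))
  let D : QOp d n → QOp d n →ₗ[ℂ] QOp d n := fun x =>
    LinearMap.mulRight ℂ x - LinearMap.mulLeft ℂ x
  have hD : ∀ X, D (embedHom d n j A') (D (embedHom d n i A) X) =
      ⁅⁅X, embedHom d n i A⁆, embedHom d n j A'⁆ := fun X => rfl
  suffices key : (d : ℂ) ^ n • ⁅⁅O, embedHom d n i A⁆, embedHom d n j A'⁆ = 0 from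
    (smul_eq_zero.mp key).resolve_left hd'
  rw [← hD, ← map_smul, ← map_smul, ← pauli_expansion, map_sum, map_sum]
  refine Finset.sum_eq_zero fun a _ => ?_
  rw [map_smul, map_smul, hD]
  by_cases hi : a i = 0
  · rw [(commute_conjTranspose_pauliN_embedHom hi A).lie_eq, Ring.lie_def, zero_mul, mul_zero, sub_zero,
      smul_zero]
  by_cases hj : a j = 0
  · have h1 := commute_conjTranspose_pauliN_embedHom hj A'
    have h2 := commute_embedHom hij A A'
    rw [commute_iff_lie_eq.mp, smul_zero]
    exact (h1.mul_left h2).sub_left (h2.mul_left h1)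
  · rw [hzero a hi hj, zero_smul]

lemma lie_lie_conjBy_embedHom [NeZero d] {U : Matrix.unitaryGroup (Fin n → Fin d) ℂ}
    (hU : ∀ O, influence d n (conjBy U O) = influence d n O) (k : Fin n)
    (A : Matrix (Fin d) (Fin d) ℂ) {i j : Fin n} (hij : i ≠ j)
    (B B' : Matrix (Fin d) (Fin d) ℂ) :
    ⁅⁅conjBy U (embedHom d n k A), embedHom d n i B⁆, embedHom d n j B'⁆ = 0 := by
  have hd : (d : ℂ) ≠ 0 := Nat.cast_ne_zero.mpr (NeZero.ne d)
  set c : ℂ := A.trace / d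
  have hA0 : (A - c • (1 : Matrix (Fin d) (Fin d) ℂ)).trace = 0 := by
    rw [Matrix.trace_sub, Matrix.trace_smul, Matrix.trace_one, Fintype.card_fin, smul_eq_mul,
      div_mul_cancel₀ _ hd, sub_self]
  have hA : ⁅conjBy U (embedHom d n k A), embedHom d n i B⁆ =
      ⁅conjBy U (embedHom d n k (A - c • 1)), embedHom d n i B⁆ := by
    rw [map_sub, map_sub, map_smul, map_smul, map_one, map_one, Ring.lie_def, Ring.lie_def,
      sub_mul, mul_sub, smul_mul_assoc, mul_smul_comm, one_mul, mul_one, sub_sub_sub_cancel_right]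
  rw [hA]
  refine lie_lie_eq_zero_of_influence_eq ?_ ?_ hij B B'
  · rw [trace_conjBy, trace_embedHom_eq_zero k hA0]
  · rw [hU, sqNorm_conjBy, influence_embedHom_eq_sqNorm k hA0]

/-- An operator such that it and its square have no components on two or more sites acts on a
single site. -/
lemma exists_embedHom_of_lie_lie_eq_zero [NeZero d] [NeZero n] {B : QOp d n}
    (h1 : ∀ i j : Fin n, i ≠ j → ∀ A A', ⁅⁅B, embedHom d n i A⁆, embedHom d n j A'⁆ = 0)
    (h2 : ∀ i j : Fin n, i ≠ j → ∀ A A', ⁅⁅B * B, embedHom d n i A⁆, embedHom d n j A'⁆ = 0) :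
    ∃ i C, B = embedHom d n i C := by
  have hlocal : ∀ i A, ∃ C, ⁅B, embedHom d n i A⁆ = embedHom d n i C := fun i A =>
    exists_embedHom_of_commute i fun j hj A' =>
      commute_iff_lie_eq.mpr (h1 i j (Ne.symm hj) A A')
  have hpair : ∀ i j, i ≠ j → ∀ A A',
      ⁅B, embedHom d n i A⁆ = 0 ∨ ⁅B, embedHom d n j A'⁆ = 0 := by
    intro i j hij A A'
    obtain ⟨C, hC⟩ := hlocal i A
    obtain ⟨C', hC'⟩ := hlocal j A'
    have hid : ∀ x y : QOp d n, ⁅⁅B * B, x⁆, y⁆ =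
        ⁅B, y⁆ * ⁅B, x⁆ + B * ⁅⁅B, x⁆, y⁆ + ⁅B, x⁆ * ⁅B, y⁆ + ⁅⁅B, x⁆, y⁆ * B := by
      intro x y
      simp only [Ring.lie_def]
      noncomm_ring
    have h := hid (embedHom d n i A) (embedHom d n j A')
    rw [h2 i j hij, h1 i j hij, hC, hC', (commute_embedHom hij C C').symm.eq, mul_zero, zero_mul,
      add_zero, add_zero, ← two_smul ℂ] at h
    have := (smul_eq_zero.mp h.symm).resolve_left two_ne_zero
    rw [hC, hC']
    refine (embedHom_mul_embedHom_eq_zero hij this).imp ?_ ?_ <;>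
    · rintro rfl
      exact map_zero _
  by_cases hex : ∃ i A, ⁅B, embedHom d n i A⁆ ≠ 0
  · obtain ⟨i, A, hiA⟩ := hex
    refine ⟨i, exists_embedHom_of_commute i fun j hj A' => ?_⟩
    exact commute_iff_lie_eq.mpr ((hpair i j (Ne.symm hj) A A').resolve_left hiA)
  · push Not at hex
    exact ⟨0, exists_embedHom_of_commute 0 fun j _ A' => commute_iff_lie_eq.mpr (hex j A')⟩

lemma exists_site_of_influence_conjBy_eq [NeZero d] [NeZero n]
    {U : Matrix.unitaryGroup (Fin n → Fin d) ℂ}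
    (hU : ∀ O, influence d n (conjBy U O) = influence d n O) (k : Fin n) :
    ∃ i, ∀ A, ∃ C, conjBy U (embedHom d n k A) = embedHom d n i C := by
  have h : ∀ A, ∃ i C, conjBy U (embedHom d n k A) = embedHom d n i C := by
    intro A
    refine exists_embedHom_of_lie_lie_eq_zero
      (fun i j hij B B' => lie_lie_conjBy_embedHom hU k A hij B B') (fun i j hij B B' => ?_)
    rw [← map_mul, ← map_mul]
    exact lie_lie_conjBy_embedHom hU k (A * A) hij B B'
  let f : Matrix (Fin d) (Fin d) ℂ →ₗ[ℂ] QOp d n :=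
    (conjBy U).toAlgEquiv.toLinearMap.comp (embedHom d n k).toAlgHom.toLinearMap
  let p : Fin n → Submodule ℂ (Matrix (Fin d) (Fin d) ℂ) := fun i =>
    (LinearMap.range (embedHom d n i).toAlgHom.toLinearMap).comap f
  have hp : ⋃ i, (p i : Set (Matrix (Fin d) (Fin d) ℂ)) = Set.univ := by
    refine Set.eq_univ_of_forall fun A => Set.mem_iUnion.mpr ?_
    obtain ⟨i, C, hC⟩ := h A
    exact ⟨i, C, hC.symm⟩
  obtain ⟨i, hi⟩ := Subspace.exists_eq_top_of_iUnion_eq_univ hp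
  refine ⟨i, fun A => ?_⟩
  obtain ⟨C, hC⟩ : A ∈ p i := hi ▸ Submodule.mem_top
  exact ⟨C, hC.symm⟩

/-- Every star automorphism of a full matrix algebra is inner. -/
lemma exists_unitary_of_starAlgEquiv
    (φ : Matrix (Fin d) (Fin d) ℂ ≃⋆ₐ[ℂ] Matrix (Fin d) (Fin d) ℂ) :
    ∃ W ∈ Matrix.unitaryGroup (Fin d) ℂ, ∀ A, φ A = W * A * star W := by
  let e := Matrix.toEuclideanCLM (𝕜 := ℂ) (n := Fin d)
  let ψ := (e.symm.trans φ).trans e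
  have hcont : Continuous ψ :=
    LinearMap.continuous_of_finiteDimensional ψ.toAlgEquiv.toLinearMap
  obtain ⟨V, hV⟩ := StarAlgEquiv.eq_linearIsometryEquivConjStarAlgEquiv ψ hcont
  rw [← Unitary.conjStarAlgAut_symm_unitaryLinearIsometryEquiv] at hV
  set u := Unitary.linearIsometryEquiv.symm V
  have hmem : e.symm u ∈ Matrix.unitaryGroup (Fin d) ℂ := by
    refine Matrix.mem_unitaryGroup_iff.mpr (EquivLike.injective e ?_)
    rw [map_mul e, map_star e, StarAlgEquiv.apply_symm_apply, map_one e]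
    exact Unitary.coe_mul_star_self u
  refine ⟨e.symm u, hmem, fun A => EquivLike.injective e ?_⟩
  have hA : ψ (e A) = e (φ A) := by
    simp [ψ]
  rw [← hA, hV, Unitary.conjStarAlgAut_apply, map_mul e, map_mul e, map_star e,
    StarAlgEquiv.apply_symm_apply]

lemma exists_unitary_conjBy_embedHom [NeZero d] {U : Matrix.unitaryGroup (Fin n → Fin d) ℂ}
    {k i : Fin n} (h : ∀ A, ∃ C, conjBy U (embedHom d n k A) = embedHom d n i C) :
    ∃ W ∈ Matrix.unitaryGroup (Fin d) ℂ,
      ∀ A, conjBy U (embedHom d n k A) = embedHom d n i (W * A * star W) := by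
  choose f hf using h
  have hinj := embedHom_injective (d := d) (n := n) i
  let F : Matrix (Fin d) (Fin d) ℂ →⋆ₐ[ℂ] Matrix (Fin d) (Fin d) ℂ :=
    { toFun := f
      map_one' := hinj (by rw [← hf, map_one, map_one, map_one])
      map_mul' := fun A B => hinj (by rw [← hf, map_mul, map_mul, map_mul, hf, hf])
      map_zero' := hinj (by rw [← hf, map_zero, map_zero, map_zero])
      map_add' := fun A B => hinj (by rw [← hf, map_add, map_add, map_add, hf, hf])
      commutes' := fun r => hinj (by
        rw [← hf, Algebra.algebraMap_eq_smul_one, map_smul, map_smul, map_smul, map_one, map_one,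
          map_one])
      map_star' := fun A => hinj (by rw [← hf, map_star, map_star, map_star, hf]) }
  have hFinj : Function.Injective F := by
    intro A B hAB
    apply embedHom_injective (d := d) (n := n) k
    apply EquivLike.injective (conjBy U)
    rw [hf, hf]
    exact congrArg _ hAB
  have hFsurj : Function.Surjective F :=
    LinearMap.injective_iff_surjective (f := F.toAlgHom.toLinearMap) |>.mp hFinj
  obtain ⟨W, hW, hφ⟩ := exists_unitary_of_starAlgEquiv (StarAlgEquiv.ofBijective F ⟨hFinj, hFsurj⟩)
  refine ⟨W, hW, fun A => ?_⟩
  rw [hf, ← hφ A]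
  rfl

lemma site_injective [NeZero d] (hd : 2 ≤ d) {U : Matrix.unitaryGroup (Fin n → Fin d) ℂ}
    {π : Fin n → Fin n} {W : Fin n → Matrix (Fin d) (Fin d) ℂ}
    (hW : ∀ k, W k ∈ Matrix.unitaryGroup (Fin d) ℂ)
    (h : ∀ k A, conjBy U (embedHom d n k A) = embedHom d n (π k) (W k * A * star (W k))) :
    Function.Injective π := by
  intro k l hkl
  by_contra hne
  have hcomm : ∀ A B : Matrix (Fin d) (Fin d) ℂ, A * B = B * A := by
    intro A B
    have hsurj : ∀ k A, conjBy U (embedHom d n k (star (W k) * A * W k)) =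
        embedHom d n (π k) A := by
      intro k A
      have hk := Matrix.mem_unitaryGroup_iff.mp (hW k)
      rw [h, mul_assoc, mul_assoc, mul_assoc, hk, mul_one, ← mul_assoc, hk, one_mul]
    have := commute_conjBy U (commute_embedHom hne (star (W k) * A * W k) (star (W l) * B * W l))
    rw [hsurj, hsurj, hkl] at this
    apply embedHom_injective (π l)
    rw [map_mul, map_mul]
    exact this
  let a : Fin d := ⟨0, by omega⟩
  let b : Fin d := ⟨1, by omega⟩
  have hab : a ≠ b := by simp [a, b]
  have := congrFun (congrFun (hcomm (Matrix.single a b 1) (Matrix.single b a 1)) a) a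
  simp [Matrix.single_mul_single_same, hab.symm] at this

lemma swapUnitary_mem_closure (i j : Fin n) :
    swapUnitary d n i j ∈ Subgroup.closure (localGenerators d n) :=
  Subgroup.subset_closure (Or.inr ⟨i, j, rfl⟩)

lemma exists_mem_closure_conjBy_eq_perm (σ : Equiv.Perm (Fin n)) :
    ∃ g ∈ Subgroup.closure (localGenerators d n),
      ∀ k A, conjBy g (embedHom d n k A) = embedHom d n (σ k) A := by
  induction σ using Equiv.Perm.swap_induction_on with
  | one =>
    refine ⟨1, one_mem _, fun k A => ?_⟩
    rw [conjBy_one_apply, Equiv.Perm.one_apply]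
  | swap_mul f x y _ ih =>
    obtain ⟨g, hg, hgk⟩ := ih
    refine ⟨swapUnitary d n x y * g, mul_mem (swapUnitary_mem_closure x y) hg, fun k A => ?_⟩
    rw [Unitary.conjStarAlgAut_mul_apply, hgk, conjBy_swapUnitary_embedHom]
    rfl

/-- A single-qudit unitary as an element of the unitary group. -/
def embedUnitary (k : Fin n) (W : Matrix.unitaryGroup (Fin d) ℂ) :
    Matrix.unitaryGroup (Fin n → Fin d) ℂ :=
  ⟨embedHom d n k W, Unitary.map_mem (embedHom d n k) W.2⟩

lemma embedUnitary_mem_closure (k : Fin n) (W : Matrix.unitaryGroup (Fin d) ℂ) :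
    embedUnitary k W ∈ Subgroup.closure (localGenerators d n) :=
  Subgroup.subset_closure (Or.inl ⟨k, W, W.2, rfl⟩)

lemma conjBy_embedUnitary_embedHom_self (k : Fin n) (W : Matrix.unitaryGroup (Fin d) ℂ)
    (A : Matrix (Fin d) (Fin d) ℂ) :
    conjBy (embedUnitary k W) (embedHom d n k A) =
      embedHom d n k (W * A * star (W : Matrix (Fin d) (Fin d) ℂ)) := by
  rw [Unitary.conjStarAlgAut_apply, map_mul, map_mul, map_star]
  rfl

lemma conjBy_embedUnitary_embedHom_of_ne {j k : Fin n} (hjk : j ≠ k)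
    (W : Matrix.unitaryGroup (Fin d) ℂ) (A : Matrix (Fin d) (Fin d) ℂ) :
    conjBy (embedUnitary j W) (embedHom d n k A) = embedHom d n k A := by
  rw [Unitary.conjStarAlgAut_apply]
  have h : (embedUnitary j W : QOp d n) * embedHom d n k A = embedHom d n k A * embedUnitary j W :=
    commute_embedHom hjk _ A
  have hu : (embedUnitary j W : QOp d n) * star (embedUnitary j W : QOp d n) = 1 :=
    Unitary.coe_mul_star_self _
  rw [h, mul_assoc, hu, mul_one]

lemma exists_mem_closure_conjBy_eq_local (W : Fin n → Matrix.unitaryGroup (Fin d) ℂ)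
    (S : Finset (Fin n)) :
    ∃ g ∈ Subgroup.closure (localGenerators d n),
      (∀ k ∈ S, ∀ A, conjBy g (embedHom d n k A) =
        embedHom d n k (W k * A * star (W k : Matrix (Fin d) (Fin d) ℂ))) ∧
      ∀ k ∉ S, ∀ A, conjBy g (embedHom d n k A) = embedHom d n k A := by
  induction S using Finset.induction_on with
  | empty =>
    refine ⟨1, one_mem _, by simp, fun k _ A => ?_⟩
    rw [conjBy_one_apply]
  | insert j S hj ih =>
    obtain ⟨g, hg, h1, h2⟩ := ih
    refine ⟨embedUnitary j (W j) * g, mul_mem (embedUnitary_mem_closure j _) hg, ?_, ?_⟩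
    · intro k hk A
      rw [Unitary.conjStarAlgAut_mul_apply]
      obtain rfl | hk := Finset.mem_insert.mp hk
      · rw [h2 k hj, conjBy_embedUnitary_embedHom_self]
      · rw [h1 k hk, conjBy_embedUnitary_embedHom_of_ne]
        rintro rfl
        exact hj hk
    · intro k hk A
      rw [Finset.mem_insert, not_or] at hk
      rw [Unitary.conjStarAlgAut_mul_apply, h2 k hk.2,
        conjBy_embedUnitary_embedHom_of_ne (Ne.symm hk.1)]

lemma mem_localGenerators_of_conjBy_eq [NeZero d] [NeZero n]
    {U : Matrix.unitaryGroup (Fin n → Fin d) ℂ}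
    (h : ∀ k A, conjBy U (embedHom d n k A) = embedHom d n k A) : U ∈ localGenerators d n := by
  have hcomm : ∀ k A, Commute (U : QOp d n) (embedHom d n k A) := by
    intro k A
    have := h k A
    rw [Unitary.conjStarAlgAut_apply] at this
    rw [Commute, SemiconjBy]
    nth_rewrite 2 [← this]
    have hu : star (U : QOp d n) * (U : QOp d n) = 1 := Unitary.coe_star_mul_self U
    rw [mul_assoc, hu, mul_one]
  obtain ⟨B, hB⟩ := exists_embedHom_of_commute 0 fun j _ A => hcomm j A
  refine Or.inl ⟨0, B, Matrix.mem_unitaryGroup_iff.mpr (embedHom_injective (0 : Fin n) ?_), hB⟩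
  rw [map_mul, map_star, ← hB, map_one]
  exact Unitary.coe_mul_star_self U

lemma mem_closure_of_influence_conjBy_eq [NeZero d] [NeZero n] (hd : 2 ≤ d)
    {U : Matrix.unitaryGroup (Fin n → Fin d) ℂ}
    (hU : ∀ O, influence d n (conjBy U O) = influence d n O) :
    U ∈ Subgroup.closure (localGenerators d n) := by
  choose π hπ using exists_site_of_influence_conjBy_eq hU
  choose W hW hUW using fun k => exists_unitary_conjBy_embedHom (hπ k)
  let σ := Equiv.ofBijective π (Finite.injective_iff_bijective.mp (site_injective hd hW hUW))
  obtain ⟨g, hg, hgk⟩ := exists_mem_closure_conjBy_eq_perm (d := d) σ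
  obtain ⟨h, hh, hhk, -⟩ :=
    exists_mem_closure_conjBy_eq_local (fun k => ⟨W k, hW k⟩) Finset.univ
  have hgh : ∀ k A, conjBy U (embedHom d n k A) = conjBy (g * h) (embedHom d n k A) := by
    intro k A
    rw [Unitary.conjStarAlgAut_mul_apply, hhk k (Finset.mem_univ k), hgk, hUW]
    rfl
  have hv : (g * h)⁻¹ * U ∈ localGenerators d n := by
    refine mem_localGenerators_of_conjBy_eq fun k A => ?_
    rw [Unitary.conjStarAlgAut_mul_apply, hgh, conjBy_inv_conjBy]
  rw [← mul_inv_cancel_left (g * h) U]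
  exact mul_mem (mul_mem hg hh) (Subgroup.subset_closure hv)

end

/-- A unitary is stable (`CiS[U] = 0`) iff it lies in the subgroup of the unitary group
generated by single-qudit unitaries and swap unitaries. -/
theorem cis_eq_zero_iff_generated (n d : ℕ) (hn : 1 ≤ n) (hd : 2 ≤ d) [NeZero d]
    (U : Matrix.unitaryGroup (Fin n → Fin d) ℂ) :
    CiS d n (U : QOp d n) = 0 ↔
    U ∈ Subgroup.closure {V : Matrix.unitaryGroup (Fin n → Fin d) ℂ |
      (∃ (j : Fin n) (W : Matrix (Fin d) (Fin d) ℂ),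
        W ∈ Matrix.unitaryGroup (Fin d) ℂ ∧ (V : QOp d n) = embedAt d n j W) ∨
      (∃ i j : Fin n, (V : QOp d n) = swapOp d n i j)} := by
  have : NeZero n := ⟨by omega⟩
  rw [cis_eq_zero_iff]
  exact ⟨mem_closure_of_influence_conjBy_eq hd, influence_conjBy_of_mem_closure⟩

end QC
end
end

section
/- Let γ_1,…,γ_{2n} be Hermitian operators on (ℂ²)^{⊗n} satisfying the Clifford-algebra relations. A unitary U on (ℂ²)^{⊗n} satisfies CiS^G[U] = 0 if and only if for every i ∈ {1,…,2n}, both U γ_i U† and U† γ_i U lie in the complex linear span of {γ_1,…,γ_{2n}} (i.e., if and only if U is a matchgate). -/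
open Matrix Complex BigOperators
open scoped ComplexOrder
noncomputable section

namespace QC

section Clifford

variable {n : ℕ} {γ : Fin (2 * n) → QOp 2 n}

/-- The Clifford-algebra relations together with hermiticity of the generators. -/
structure IsMajorana (γ : Fin (2 * n) → QOp 2 n) : Prop where
  herm : ∀ i, (γ i).IsHermitian
  car : ∀ i j, γ i * γ j + γ j * γ i = if i = j then (2 : ℂ) • (1 : QOp 2 n) else 0

/-- The sign picked up by `γ^S` under conjugation by `γ_i`. -/
def gammaSign (i : Fin (2 * n)) (S : Finset (Fin (2 * n))) : ℤ :=
  (-1) ^ (S.card + if i ∈ S then 1 else 0)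

lemma gammaSign_sep {S S' : Finset (Fin (2 * n))} (h : ∀ i, gammaSign i S = gammaSign i S') :
    S = S' := by
  have key : ∀ i, Even (S.card + if i ∈ S then 1 else 0) ↔
      Even (S'.card + if i ∈ S' then 1 else 0) := by
    intro i
    have hi := h i
    unfold gammaSign at hi
    rw [← neg_one_pow_eq_one_iff_even (R := ℤ) (by norm_num), hi,
      neg_one_pow_eq_one_iff_even (by norm_num)]
  by_cases hp : Even S.card ↔ Even S'.card
  · ext i
    have := key i
    split_ifs at this <;> simp only [Nat.even_add_one, add_zero] at this <;> tauto
  · have hc : S' = Sᶜ := by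
      ext i
      have := key i
      rw [Finset.mem_compl]
      split_ifs at this <;> simp only [Nat.even_add_one, add_zero] at this <;> tauto
    have hcard := Finset.card_add_card_compl S
    rw [← hc, Fintype.card_fin] at hcard
    exfalso
    apply hp
    have : Even (S.card + S'.card) := by rw [hcard]; exact even_two_mul n
    exact Nat.even_add.mp this

lemma sum_gammaSign (S : Finset (Fin (2 * n))) :
    ∑ i, gammaSign i S = (-1) ^ S.card * (2 * (n : ℤ) - 2 * S.card) := by
  have h : ∀ i, gammaSign i S = (-1) ^ S.card * (1 - 2 * if i ∈ S then 1 else 0) := by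
    intro i
    unfold gammaSign
    split_ifs <;> ring
  simp only [h, ← Finset.mul_sum, Finset.sum_sub_distrib]
  simp

lemma card_eq_of_sum_gammaSign_eq {S S' : Finset (Fin (2 * n))}
    (h : ∑ i, gammaSign i S = ∑ i, gammaSign i S') : S.card = S'.card := by
  rw [sum_gammaSign, sum_gammaSign] at h
  rcases Nat.even_or_odd S.card with h1 | h1 <;> rcases Nat.even_or_odd S'.card with h2 | h2 <;>
    rw [h1.neg_one_pow, h2.neg_one_pow] at h <;>
    obtain ⟨a, ha⟩ := h1 <;> obtain ⟨b, hb⟩ := h2 <;> omega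

lemma gammaProd_empty : gammaProd n γ ∅ = 1 := by simp [gammaProd]

lemma gammaProd_singleton (i : Fin (2 * n)) : gammaProd n γ {i} = γ i := by simp [gammaProd]

namespace IsMajorana

lemma mul_self (hγ : IsMajorana γ) (i : Fin (2 * n)) : γ i * γ i = 1 := by
  have h := hγ.car i i
  rw [if_pos rfl, ← two_smul ℂ] at h
  exact smul_right_injective _ (two_ne_zero) h

lemma mul_list_prod (hγ : IsMajorana γ) (i : Fin (2 * n)) (l : List (Fin (2 * n))) :
    γ i * (l.map γ).prod = (-1 : ℤ) ^ (l.length + l.count i) • ((l.map γ).prod * γ i) := by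
  induction l with
  | nil => simp
  | cons j l ih =>
    have hj : γ i * γ j = (-1 : ℤ) ^ (1 + if j = i then 1 else 0) • (γ j * γ i) := by
      split_ifs with h
      · simp [h]
      · have := hγ.car i j
        rw [if_neg (Ne.symm h)] at this
        simpa using eq_neg_of_add_eq_zero_left this
    rw [List.map_cons, List.prod_cons, ← mul_assoc, hj, smul_mul_assoc, mul_assoc, ih,
      mul_smul_comm, smul_smul, ← pow_add, mul_assoc, List.length_cons, List.count_cons]
    congr 2
    simp only [beq_iff_eq]
    ring

lemma conj_gammaProd (hγ : IsMajorana γ) (i : Fin (2 * n)) (S : Finset (Fin (2 * n))) :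
    γ i * gammaProd n γ S * γ i = gammaSign i S • gammaProd n γ S := by
  have hc : (S.sort (· ≤ ·)).count i = if i ∈ S then 1 else 0 := by
    rw [List.Nodup.count (S.sort_nodup _)]
    simp
  unfold gammaProd gammaSign
  rw [hγ.mul_list_prod, hc, Finset.length_sort, smul_mul_assoc, mul_assoc, hγ.mul_self, mul_one]

lemma gammaProd_conjTranspose_mul_self (hγ : IsMajorana γ) (S : Finset (Fin (2 * n))) :
    (gammaProd n γ S)ᴴ * gammaProd n γ S = 1 := by
  have h : gammaProd n γ S ∈ Matrix.unitaryGroup (Fin n → Fin 2) ℂ := by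
    apply Submonoid.list_prod_mem
    intro x hx
    obtain ⟨i, -, rfl⟩ := List.mem_map.mp hx
    rw [Matrix.mem_unitaryGroup_iff, Matrix.star_eq_conjTranspose, hγ.herm i, hγ.mul_self]
  exact Matrix.mem_unitaryGroup_iff'.mp h

/-- Conjugation by `γ_i` is self-adjoint for the trace inner product. -/
lemma trace_conj (hγ : IsMajorana γ) (i : Fin (2 * n)) (A B : QOp 2 n) :
    ((γ i * A * γ i)ᴴ * B).trace = (Aᴴ * (γ i * B * γ i)).trace := by
  rw [Matrix.conjTranspose_mul, Matrix.conjTranspose_mul, (hγ.herm i).eq, mul_assoc,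
    Matrix.trace_mul_comm]
  simp only [mul_assoc]

lemma trace_gammaProd (hγ : IsMajorana γ) (S S' : Finset (Fin (2 * n))) :
    ((gammaProd n γ S)ᴴ * gammaProd n γ S').trace = if S = S' then (2 : ℂ) ^ n else 0 := by
  split_ifs with h
  · rw [← h, hγ.gammaProd_conjTranspose_mul_self]
    simp
  · obtain ⟨i, hi⟩ : ∃ i, gammaSign i S ≠ gammaSign i S' := by
      by_contra! hall
      exact h (gammaSign_sep hall)
    have key := hγ.trace_conj i (gammaProd n γ S) (gammaProd n γ S')
    rw [hγ.conj_gammaProd, hγ.conj_gammaProd, Matrix.conjTranspose_smul, smul_mul_assoc,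
      mul_smul_comm, Matrix.trace_smul, Matrix.trace_smul, star_trivial, ← sub_eq_zero,
      ← sub_smul] at key
    exact (smul_eq_zero.mp key).resolve_left (sub_ne_zero.mpr hi)

lemma linearIndependent_gammaProd (hγ : IsMajorana γ) :
    LinearIndependent ℂ (gammaProd n γ) := by
  rw [Fintype.linearIndependent_iff]
  intro g hg S
  have h := congrArg (fun A => ((gammaProd n γ S)ᴴ * A).trace) hg
  simpa [Finset.mul_sum, Matrix.trace_sum, hγ.trace_gammaProd] using h

lemma span_gammaProd (hγ : IsMajorana γ) :
    Submodule.span ℂ (Set.range (gammaProd n γ)) = ⊤ := by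
  apply hγ.linearIndependent_gammaProd.span_eq_top_of_card_eq_finrank'
  simp [Module.finrank_matrix, pow_mul, ← mul_pow]

lemma sum_trace_smul_gammaProd (hγ : IsMajorana γ) (O : QOp 2 n) :
    ∑ S, (((gammaProd n γ S)ᴴ * O).trace / 2 ^ n) • gammaProd n γ S = O := by
  have hO : O ∈ Submodule.span ℂ (Set.range (gammaProd n γ)) := by
    rw [hγ.span_gammaProd]; trivial
  obtain ⟨c, rfl⟩ := (Submodule.mem_span_range_iff_exists_fun ℂ).mp hO
  refine Finset.sum_congr rfl fun S _ => ?_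
  congr 1
  simp [Finset.mul_sum, Matrix.trace_sum, hγ.trace_gammaProd]

end IsMajorana

lemma pdistG_nonneg (O : QOp 2 n) (S : Finset (Fin (2 * n))) : 0 ≤ pdistG n γ O S := by
  unfold pdistG; positivity

lemma ofReal_pdistG (O : QOp 2 n) (S : Finset (Fin (2 * n))) :
    (pdistG n γ O S : ℂ) =
      (((gammaProd n γ S)ᴴ * O).trace / 2 ^ n) * (Oᴴ * gammaProd n γ S).trace / 2 ^ n := by
  have h : (Oᴴ * gammaProd n γ S).trace = star ((gammaProd n γ S)ᴴ * O).trace := by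
    rw [← Matrix.trace_conjTranspose, Matrix.conjTranspose_mul, Matrix.conjTranspose_conjTranspose]
  rw [h, pdistG]
  push_cast
  rw [← Complex.mul_conj', two_mul, pow_add, ← starRingEnd_apply]
  field_simp

/-- The number operator `O ↦ ∑_S |S| ⟨γ^S, O⟩ γ^S`. -/
def numberOp (γ : Fin (2 * n) → QOp 2 n) (O : QOp 2 n) : QOp 2 n :=
  ∑ S, ((S.card : ℂ) * (((gammaProd n γ S)ᴴ * O).trace / 2 ^ n)) • gammaProd n γ S

lemma ofReal_influenceG (O : QOp 2 n) :
    (influenceG n γ O : ℂ) = (Oᴴ * numberOp γ O).trace / 2 ^ n := by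
  simp only [influenceG, numberOp, Complex.ofReal_sum, Complex.ofReal_mul, ofReal_pdistG,
    Finset.mul_sum, Matrix.trace_sum, Finset.sum_div, mul_smul_comm, Matrix.trace_smul, smul_eq_mul]
  refine Finset.sum_congr rfl fun S _ => ?_
  push_cast
  ring

lemma numberOp_add (A B : QOp 2 n) : numberOp γ (A + B) = numberOp γ A + numberOp γ B := by
  simp only [numberOp, mul_add, Matrix.trace_add, add_div, add_smul, Finset.sum_add_distrib]

lemma numberOp_smul (c : ℂ) (A : QOp 2 n) : numberOp γ (c • A) = c • numberOp γ A := by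
  simp only [numberOp, Finset.smul_sum, mul_smul_comm, Matrix.trace_smul, smul_smul, smul_eq_mul]
  refine Finset.sum_congr rfl fun S _ => ?_
  congr 1
  ring

namespace IsMajorana

lemma sum_pdistG (hγ : IsMajorana γ) (O : QOp 2 n) :
    ((∑ S, pdistG n γ O S : ℝ) : ℂ) = (Oᴴ * O).trace / 2 ^ n := by
  nth_rw 3 [← hγ.sum_trace_smul_gammaProd O]
  simp only [Complex.ofReal_sum, ofReal_pdistG, Finset.mul_sum, Matrix.trace_sum, Finset.sum_div,
    mul_smul_comm, Matrix.trace_smul, smul_eq_mul]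

lemma sum_pdistG_eq_one (hγ : IsMajorana γ) {O : QOp 2 n} (hO : l2norm 2 n O = 1) :
    ∑ S, pdistG n γ O S = 1 := by
  rw [l2norm, Real.sqrt_eq_one] at hO
  rw [← hO]
  have h := congrArg Complex.re (hγ.sum_pdistG O)
  rw [Complex.ofReal_re] at h
  rw [h, show (2 : ℂ) ^ n = (((2 : ℕ) : ℝ) ^ n : ℝ) by push_cast; rfl, Complex.div_ofReal_re]

lemma influenceG_mem_Icc (hγ : IsMajorana γ) {O : QOp 2 n} (hO : l2norm 2 n O = 1) :
    influenceG n γ O ∈ Set.Icc (0 : ℝ) (2 * n) := by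
  constructor
  · exact Finset.sum_nonneg fun S _ => mul_nonneg (Nat.cast_nonneg _) (pdistG_nonneg O S)
  · calc influenceG n γ O ≤ ∑ S, (2 * n : ℝ) * pdistG n γ O S := by
          refine Finset.sum_le_sum fun S _ => mul_le_mul_of_nonneg_right ?_ (pdistG_nonneg O S)
          have := Finset.card_le_univ S
          rw [Fintype.card_fin] at this
          exact_mod_cast this
      _ = 2 * n := by rw [← Finset.mul_sum, hγ.sum_pdistG_eq_one hO, mul_one]

lemma l2norm_generator (hγ : IsMajorana γ) (i : Fin (2 * n)) : l2norm 2 n (γ i) = 1 := by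
  rw [l2norm, (hγ.herm i).eq, hγ.mul_self, Real.sqrt_eq_one, Matrix.trace_one]
  norm_cast
  simp

lemma trace_generator (hγ : IsMajorana γ) (i : Fin (2 * n)) : (γ i).trace = 0 := by
  have h := hγ.trace_gammaProd ∅ {i}
  rwa [gammaProd_empty, gammaProd_singleton, Matrix.conjTranspose_one, one_mul,
    if_neg (Finset.singleton_ne_empty i).symm] at h

lemma influenceG_generator (hγ : IsMajorana γ) (i : Fin (2 * n)) : influenceG n γ (γ i) = 1 := by
  have h : ∀ S, pdistG n γ (γ i) S = if S = {i} then 1 else 0 := by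
    intro S
    rw [pdistG, ← gammaProd_singleton (γ := γ) i, hγ.trace_gammaProd]
    split_ifs
    · simp [← pow_mul, mul_comm]
    · simp
  simp [influenceG, h]

/-- A normalized traceless operator of influence one is linear in the generators. -/
lemma mem_span_of_influenceG_eq_one (hγ : IsMajorana γ) {O : QOp 2 n} (hO : l2norm 2 n O = 1)
    (htr : O.trace = 0) (hI : influenceG n γ O = 1) :
    O ∈ Submodule.span ℂ (Set.range γ) := by
  have hempty : pdistG n γ O ∅ = 0 := by simp [pdistG, gammaProd_empty, htr]
  have hnn : ∀ S ∈ Finset.univ, 0 ≤ ((S.card : ℝ) - 1) * pdistG n γ O S := by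
    intro S _
    rcases S.eq_empty_or_nonempty with rfl | hS
    · simp [hempty]
    · refine mul_nonneg (sub_nonneg.mpr ?_) (pdistG_nonneg O S)
      exact_mod_cast hS.card_pos
  have hsum : ∑ S, ((S.card : ℝ) - 1) * pdistG n γ O S = 0 := by
    simp only [sub_mul, one_mul, Finset.sum_sub_distrib, hγ.sum_pdistG_eq_one hO]
    exact sub_eq_zero.mpr hI
  have hz := (Finset.sum_eq_zero_iff_of_nonneg hnn).mp hsum
  rw [← hγ.sum_trace_smul_gammaProd O]
  refine Submodule.sum_mem _ fun S _ => ?_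
  by_cases hS : S.card = 1
  · obtain ⟨i, rfl⟩ := Finset.card_eq_one.mp hS
    rw [gammaProd_singleton]
    exact Submodule.smul_mem _ _ (Submodule.subset_span ⟨i, rfl⟩)
  · have h := (mul_eq_zero.mp (hz S (Finset.mem_univ S))).resolve_left
      (sub_ne_zero.mpr (by exact_mod_cast hS))
    have h0 : ((gammaProd n γ S)ᴴ * O).trace = 0 := by simpa [pdistG] using h
    simp [h0]

/-- An eigenvector of `O ↦ ∑ i, γ_i O γ_i` with the eigenvalue of `γ^S` is homogeneous of
degree `|S|`. -/
lemma numberOp_of_eigen (hγ : IsMajorana γ) {S : Finset (Fin (2 * n))} {O : QOp 2 n}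
    (hO : ∑ i, γ i * O * γ i = (∑ i, gammaSign i S) • O) :
    numberOp γ O = (S.card : ℂ) • O := by
  nth_rw 2 [← hγ.sum_trace_smul_gammaProd O]
  rw [numberOp, Finset.smul_sum]
  refine Finset.sum_congr rfl fun S' _ => ?_
  rw [smul_smul]
  by_cases hS : S'.card = S.card
  · rw [hS]
  · have h0 : ((gammaProd n γ S')ᴴ * O).trace = 0 := by
      have h : ∑ i, ((γ i * gammaProd n γ S' * γ i)ᴴ * O).trace =
          ∑ i, ((gammaProd n γ S')ᴴ * (γ i * O * γ i)).trace :=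
        Finset.sum_congr rfl fun i _ => hγ.trace_conj i _ _
      rw [← Matrix.trace_sum Finset.univ (fun i => (gammaProd n γ S')ᴴ * (γ i * O * γ i)),
        ← Finset.mul_sum, hO] at h
      simp only [hγ.conj_gammaProd, Matrix.conjTranspose_smul, smul_mul_assoc, mul_smul_comm,
        Matrix.trace_smul, star_trivial, ← Finset.sum_smul] at h
      rw [← sub_eq_zero, ← sub_smul] at h
      exact (smul_eq_zero.mp h).resolve_left
        (sub_ne_zero.mpr fun h' => hS (card_eq_of_sum_gammaSign_eq h'))
    simp [h0]

/-- Conjugation by a matchgate commutes with `O ↦ ∑ i, γ_i O γ_i`. -/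
lemma sum_conj_comm (hγ : IsMajorana γ) {U : QOp 2 n} (hU : Uᴴ * U = 1)
    (hV : U * Uᴴ = 1) (hspan : ∀ i, U * γ i * Uᴴ ∈ Submodule.span ℂ (Set.range γ)) (O : QOp 2 n) :
    ∑ i, γ i * (U * O * Uᴴ) * γ i = U * (∑ i, γ i * O * γ i) * Uᴴ := by
  choose R hR using fun i => (Submodule.mem_span_range_iff_exists_fun ℂ).mp (hspan i)
  have hconj : ∀ A B : QOp 2 n, U * A * Uᴴ * (U * B * Uᴴ) = U * (A * B) * Uᴴ := fun A B => by
    calc U * A * Uᴴ * (U * B * Uᴴ) = U * A * (Uᴴ * U) * B * Uᴴ := by simp only [mul_assoc]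
      _ = U * (A * B) * Uᴴ := by rw [hU, mul_one, mul_assoc U A B]
  have hRR : Matrix.of R * (Matrix.of R)ᵀ = 1 := by
    ext i j
    have h : (2 * ∑ k, R i k * R j k) • (1 : QOp 2 n) =
        (2 * if i = j then 1 else 0 : ℂ) • (1 : QOp 2 n) := by
      calc (2 * ∑ k, R i k * R j k) • (1 : QOp 2 n)
          = ∑ k, ∑ l, (R i k * R j l) • (γ k * γ l + γ l * γ k) := by
            simp only [hγ.car, smul_ite, smul_zero, Finset.sum_ite_eq, Finset.mem_univ, if_true,
              smul_smul, ← Finset.sum_smul, ← Finset.sum_mul, mul_comm]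
        _ = U * γ i * Uᴴ * (U * γ j * Uᴴ) + U * γ j * Uᴴ * (U * γ i * Uᴴ) := by
            rw [← hR i, ← hR j, Finset.sum_mul_sum, Finset.sum_mul_sum,
              Finset.sum_comm (f := fun l k => R j l • γ l * R i k • γ k),
              ← Finset.sum_add_distrib]
            refine Finset.sum_congr rfl fun k _ => ?_
            rw [← Finset.sum_add_distrib]
            refine Finset.sum_congr rfl fun l _ => ?_
            rw [smul_mul_smul_comm, smul_mul_smul_comm, smul_add, mul_comm (R j l)]
        _ = (2 * if i = j then 1 else 0 : ℂ) • (1 : QOp 2 n) := by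
            rw [hconj, hconj, ← add_mul, ← mul_add, hγ.car]
            split_ifs <;> simp [hV]
    have h' := mul_left_cancel₀ two_ne_zero (smul_left_injective ℂ one_ne_zero h)
    simpa [Matrix.mul_apply, Matrix.one_apply] using h'
  have hRR' : ∀ k l, ∑ i, R i k * R i l = if k = l then 1 else 0 := by
    intro k l
    have hRtR : (Matrix.of R)ᵀ * Matrix.of R = 1 := mul_eq_one_comm.mp hRR
    have h := congrFun (congrFun hRtR k) l
    simpa [Matrix.mul_apply, Matrix.one_apply] using h
  calc ∑ i, γ i * (U * O * Uᴴ) * γ i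
      = ∑ k, ∑ l, (∑ i, R i k * R i l) • (γ k * (U * O * Uᴴ) * γ l) := by
        simp [hRR']
    _ = ∑ i, U * γ i * Uᴴ * (U * O * Uᴴ) * (U * γ i * Uᴴ) := by
        simp only [Finset.sum_smul]
        rw [Finset.sum_congr rfl fun k _ => Finset.sum_comm, Finset.sum_comm]
        refine Finset.sum_congr rfl fun i _ => ?_
        rw [← hR i, Finset.sum_mul, Finset.sum_mul_sum]
        simp only [smul_mul_assoc, mul_smul_comm, smul_smul, mul_comm]
    _ = U * (∑ i, γ i * O * γ i) * Uᴴ := by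
        simp only [hconj, Finset.sum_mul, Finset.mul_sum]

lemma numberOp_conj (hγ : IsMajorana γ) {U : QOp 2 n} (hU : Uᴴ * U = 1)
    (hV : U * Uᴴ = 1) (hspan : ∀ i, U * γ i * Uᴴ ∈ Submodule.span ℂ (Set.range γ)) (O : QOp 2 n) :
    numberOp γ (U * O * Uᴴ) = U * numberOp γ O * Uᴴ := by
  have hO : O ∈ Submodule.span ℂ (Set.range (gammaProd n γ)) := by
    rw [hγ.span_gammaProd]; trivial
  induction hO using Submodule.span_induction with
  | mem x hx =>
    obtain ⟨S, rfl⟩ := hx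
    have h : ∑ i, γ i * gammaProd n γ S * γ i = (∑ i, gammaSign i S) • gammaProd n γ S := by
      simp only [hγ.conj_gammaProd, Finset.sum_smul]
    have h' : ∑ i, γ i * (U * gammaProd n γ S * Uᴴ) * γ i =
        (∑ i, gammaSign i S) • (U * gammaProd n γ S * Uᴴ) := by
      rw [hγ.sum_conj_comm hU hV hspan, h, mul_smul_comm, smul_mul_assoc]
    rw [hγ.numberOp_of_eigen h, hγ.numberOp_of_eigen h', mul_smul_comm, smul_mul_assoc]
  | zero => simp [numberOp]
  | add x y _ _ hx hy => rw [mul_add, add_mul, numberOp_add, hx, hy, numberOp_add, mul_add, add_mul]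
  | smul c x _ hx =>
    rw [mul_smul_comm, smul_mul_assoc, numberOp_smul, hx, numberOp_smul, mul_smul_comm,
      smul_mul_assoc]

end IsMajorana

lemma trace_conj_unitary {U : QOp 2 n} (hU : Uᴴ * U = 1) (A : QOp 2 n) :
    (U * A * Uᴴ).trace = A.trace := by
  rw [Matrix.trace_mul_comm, ← mul_assoc, hU, one_mul]

lemma conjTranspose_conj_mul_conj {U : QOp 2 n} (hU : Uᴴ * U = 1) (A B : QOp 2 n) :
    (U * A * Uᴴ)ᴴ * (U * B * Uᴴ) = U * (Aᴴ * B) * Uᴴ := by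
  calc (U * A * Uᴴ)ᴴ * (U * B * Uᴴ) = U * Aᴴ * (Uᴴ * U) * B * Uᴴ := by
        simp only [Matrix.conjTranspose_mul, Matrix.conjTranspose_conjTranspose, mul_assoc]
    _ = U * (Aᴴ * B) * Uᴴ := by rw [hU, mul_one, mul_assoc U]

lemma l2norm_conj {U : QOp 2 n} (hU : Uᴴ * U = 1) (O : QOp 2 n) :
    l2norm 2 n (U * O * Uᴴ) = l2norm 2 n O := by
  rw [l2norm, l2norm, conjTranspose_conj_mul_conj hU, trace_conj_unitary hU]

lemma IsMajorana.influenceG_conj (hγ : IsMajorana γ) {U : QOp 2 n} (hU : Uᴴ * U = 1)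
    (hV : U * Uᴴ = 1) (hspan : ∀ i, U * γ i * Uᴴ ∈ Submodule.span ℂ (Set.range γ)) (O : QOp 2 n) :
    influenceG n γ (U * O * Uᴴ) = influenceG n γ O := by
  apply Complex.ofReal_injective
  rw [ofReal_influenceG, ofReal_influenceG, hγ.numberOp_conj hU hV hspan,
    conjTranspose_conj_mul_conj hU, trace_conj_unitary hU]

lemma IsMajorana.influenceG_conj_of_CiSG_eq_zero (hγ : IsMajorana γ) {U : QOp 2 n}
    (hU : Uᴴ * U = 1) (h : CiSG n γ U = 0) {O : QOp 2 n} (hO : l2norm 2 n O = 1) :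
    influenceG n γ (U * O * Uᴴ) = influenceG n γ O := by
  have hbdd : BddAbove {x : ℝ | ∃ O : QOp 2 n, l2norm 2 n O = 1 ∧
      x = |influenceG n γ (U * O * Uᴴ) - influenceG n γ O|} := by
    refine ⟨2 * n, ?_⟩
    rintro x ⟨A, hA, rfl⟩
    have h1 := hγ.influenceG_mem_Icc hA
    have h2 := hγ.influenceG_mem_Icc ((l2norm_conj hU A).trans hA)
    rw [abs_le]
    constructor <;> linarith [h1.1, h1.2, h2.1, h2.2]
  have hle := le_csSup hbdd ⟨O, hO, rfl⟩
  rw [← CiSG, h] at hle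
  exact sub_eq_zero.mp (abs_nonpos_iff.mp hle)

end Clifford

/-- **Matchgates via sensitivity**: `CiS^G[U] = 0` iff `U` conjugates each Clifford-algebra
generator (in both directions) into the linear span of the generators. -/
theorem cisg_eq_zero_iff_matchgate (n : ℕ) (hn : 1 ≤ n)
    (γ : Fin (2 * n) → QOp 2 n) (hherm : ∀ i, (γ i).IsHermitian)
    (hcar : ∀ i j, γ i * γ j + γ j * γ i = if i = j then (2 : ℂ) • (1 : QOp 2 n) else 0)
    (U : QOp 2 n) (hU : U ∈ Matrix.unitaryGroup (Fin n → Fin 2) ℂ) :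
    CiSG n γ U = 0 ↔
    ∀ i, U * γ i * Uᴴ ∈ Submodule.span ℂ (Set.range γ) ∧
         Uᴴ * γ i * U ∈ Submodule.span ℂ (Set.range γ) := by
  have hγ : IsMajorana γ := ⟨hherm, hcar⟩
  have hU1 : Uᴴ * U = 1 := Matrix.mem_unitaryGroup_iff'.mp hU
  have hU2 : U * Uᴴ = 1 := Matrix.mem_unitaryGroup_iff.mp hU
  constructor
  · intro h i
    have hback : U * (Uᴴ * γ i * U) * Uᴴ = γ i := by
      calc U * (Uᴴ * γ i * U) * Uᴴ = (U * Uᴴ) * γ i * (U * Uᴴ) := by simp only [mul_assoc]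
        _ = γ i := by rw [hU2, one_mul, mul_one]
    have hnorm : l2norm 2 n (Uᴴ * γ i * U) = 1 := by
      rw [← hγ.l2norm_generator i, ← l2norm_conj hU1, hback]
    constructor
    · apply hγ.mem_span_of_influenceG_eq_one
      · rw [l2norm_conj hU1, hγ.l2norm_generator]
      · rw [trace_conj_unitary hU1, hγ.trace_generator]
      · rw [hγ.influenceG_conj_of_CiSG_eq_zero hU1 h (hγ.l2norm_generator i),
          hγ.influenceG_generator]
    · apply hγ.mem_span_of_influenceG_eq_one hnorm
      · rw [← trace_conj_unitary hU1, hback, hγ.trace_generator]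
      · rw [← hγ.influenceG_conj_of_CiSG_eq_zero hU1 h hnorm, hback, hγ.influenceG_generator]
  · intro h
    have hzero : ∀ x ∈ {x : ℝ | ∃ O : QOp 2 n, l2norm 2 n O = 1 ∧
        x = |influenceG n γ (U * O * Uᴴ) - influenceG n γ O|}, x = 0 := by
      rintro x ⟨O, -, rfl⟩
      rw [hγ.influenceG_conj hU1 hU2 fun i => (h i).1, sub_self, abs_zero]
    exact le_antisymm (Real.sSup_nonpos fun x hx => (hzero x hx).le)
      (Real.sSup_nonneg fun x hx => (hzero x hx).ge)

end QC
end
end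

section
/- Let c ≥ 0. If every Hermitian operator O on (ℂ²)^{⊗n} with O² = I satisfies H[O] ≤ c·I[O], then every Boolean function f : {−1,1}^n → {−1,1} satisfies H[f] ≤ c·I[f]. (In particular, the quantum Fourier entropy–influence conjecture implies the classical Fourier entropy–influence conjecture.) -/
open Matrix Complex BigOperators
open scoped ComplexOrder
noncomputable section

namespace QC

/-- The Pauli label `Z^S`: `(0,1)` on `S` and `(0,0)` elsewhere. -/
def zLabel (n : ℕ) (S : Finset (Fin n)) : Fin n → ZMod 2 × ZMod 2 :=
  fun i => if i ∈ S then (0, 1) else 0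

lemma zLabel_injective (n : ℕ) : Function.Injective (zLabel n) := by
  intro S T h
  ext i
  have := congrFun h i
  by_cases hS : i ∈ S <;> by_cases hT : i ∈ T <;> simp_all [zLabel, Prod.ext_iff]

lemma exists_fst_ne_zero_of_notMem_range_zLabel {n : ℕ} {a : Fin n → ZMod 2 × ZMod 2}
    (ha : a ∉ Set.range (zLabel n)) : ∃ i, (a i).1 ≠ 0 := by
  by_contra! h
  refine ha ⟨Finset.univ.filter (fun i => a i ≠ 0), funext fun i => ?_⟩
  have key : ∀ b : ZMod 2 × ZMod 2, b.1 = 0 → (if b ≠ 0 then (0, 1) else 0) = b := by decide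
  simpa [zLabel] using key (a i) (h i)

lemma weight_zLabel (n : ℕ) (S : Finset (Fin n)) : weight 2 n (zLabel n S) = S.card := by
  simp [weight, zLabel]

lemma pauli1_two_zero : pauli1 2 0 = 1 := by
  simp [pauli1]

lemma shiftX_two_apply_self (j : Fin 2) : shiftX 2 j j = 0 := by
  fin_cases j <;> simp [shiftX]

lemma pauli1_two_apply_self_of_fst_ne_zero {a : ZMod 2 × ZMod 2} (ha : a.1 ≠ 0) (j : Fin 2) :
    pauli1 2 a j j = 0 := by
  have h1 : ∀ s : ZMod 2, s ≠ 0 → s.val = 1 := by decide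
  have hZ : clockZ 2 ^ a.2.val = Matrix.diagonal
      ((fun j : Fin 2 => Complex.exp (2 * Real.pi * Complex.I * (j : ℕ) / (2 : ℕ))) ^ a.2.val) := by
    rw [clockZ, Matrix.diagonal_pow]
  rw [pauli1, h1 _ ha, pow_one, hZ, Matrix.mul_diagonal, shiftX_two_apply_self, zero_mul]

lemma pauli1_two_zero_one_apply_self (j : Fin 2) :
    pauli1 2 (0, 1) j j = if j = 1 then -1 else 1 := by
  have h : (1 : ZMod 2).val = 1 := rfl
  have hexp : Complex.exp (2 * Real.pi * Complex.I / 2) = -1 := by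
    rw [← Complex.exp_pi_mul_I]
    congr 1
    ring
  fin_cases j <;> simp [pauli1, h, clockZ, hexp]

/-- Identification of computational basis labels with points of the Boolean cube. -/
def bitsEquiv (n : ℕ) : (Fin n → Fin 2) ≃ (Fin n → Bool) :=
  Equiv.arrowCongr (Equiv.refl _) finTwoEquiv

lemma bitsEquiv_apply (n : ℕ) (x : Fin n → Fin 2) (i : Fin n) :
    bitsEquiv n x i = true ↔ x i = 1 := by
  have key : ∀ j : Fin 2, finTwoEquiv j = true ↔ j = 1 := by decide
  exact key (x i)

/-- The diagonal operator `∑_x f(x) |x⟩⟨x|` of a function on the Boolean cube. -/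
def diagOp (n : ℕ) (f : (Fin n → Bool) → ℝ) : QOp 2 n :=
  Matrix.diagonal fun x => (f (bitsEquiv n x) : ℂ)

lemma diagOp_isHermitian (n : ℕ) (f : (Fin n → Bool) → ℝ) : (diagOp n f).IsHermitian := by
  refine Matrix.isHermitian_diagonal_of_self_adjoint _ ?_
  ext x
  simp

lemma diagOp_mul_self (n : ℕ) {f : (Fin n → Bool) → ℝ} (hf : ∀ x, f x = 1 ∨ f x = -1) :
    diagOp n f * diagOp n f = 1 := by
  rw [diagOp, Matrix.diagonal_mul_diagonal, ← Matrix.diagonal_one]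
  congr 1
  funext x
  rcases hf (bitsEquiv n x) with h | h <;> simp [h]

lemma trace_diagOp_mul_pauliN (n : ℕ) (f : (Fin n → Bool) → ℝ) (a : Fin n → ZMod 2 × ZMod 2) :
    (diagOp n f * pauliN 2 n a).trace =
      ∑ x, (f (bitsEquiv n x) : ℂ) * ∏ i, pauli1 2 (a i) (x i) (x i) := by
  simp [Matrix.trace, diagOp, Matrix.diagonal_mul, pauliN]

lemma pdist_diagOp_eq_zero {n : ℕ} (f : (Fin n → Bool) → ℝ) {a : Fin n → ZMod 2 × ZMod 2}
    (ha : a ∉ Set.range (zLabel n)) : pdist 2 n (diagOp n f) a = 0 := by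
  obtain ⟨i, hi⟩ := exists_fst_ne_zero_of_notMem_range_zLabel ha
  have : (diagOp n f * pauliN 2 n a).trace = 0 := by
    rw [trace_diagOp_mul_pauliN]
    refine Finset.sum_eq_zero fun x _ => ?_
    rw [Finset.prod_eq_zero (Finset.mem_univ i) (pauli1_two_apply_self_of_fst_ne_zero hi _),
      mul_zero]
  simp [pdist, this]

lemma trace_diagOp_mul_pauliN_zLabel (n : ℕ) (f : (Fin n → Bool) → ℝ) (S : Finset (Fin n)) :
    (diagOp n f * pauliN 2 n (zLabel n S)).trace = ((fourierCoeff n f S * 2 ^ n : ℝ) : ℂ) := by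
  rw [trace_diagOp_mul_pauliN, fourierCoeff, div_mul_cancel₀ _ (by positivity),
    ← (bitsEquiv n).sum_comp]
  push_cast
  refine Finset.sum_congr rfl fun x _ => ?_
  congr 1
  rw [← Finset.prod_subset (Finset.subset_univ S)]
  · refine Finset.prod_congr rfl fun i hi => ?_
    simp only [zLabel, if_pos hi, pauli1_two_zero_one_apply_self, bitsEquiv_apply]
    split_ifs <;> simp
  · intro i _ hi
    simp [zLabel, hi, pauli1_two_zero]

lemma pdist_diagOp_zLabel (n : ℕ) (f : (Fin n → Bool) → ℝ) (S : Finset (Fin n)) :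
    pdist 2 n (diagOp n f) (zLabel n S) = fourierCoeff n f S ^ 2 := by
  rw [pdist, trace_diagOp_mul_pauliN_zLabel, Complex.norm_real, Real.norm_eq_abs, sq_abs,
    mul_pow, ← pow_mul, mul_comm n 2, Nat.cast_ofNat, mul_div_cancel_right₀ _ (by positivity)]

lemma influence_diagOp (n : ℕ) (f : (Fin n → Bool) → ℝ) :
    influence 2 n (diagOp n f) = boolInfluence n f := by
  refine (Fintype.sum_of_injective (zLabel n) (zLabel_injective n) _ _ ?_ ?_).symm
  · intro a ha
    simp [pdist_diagOp_eq_zero f ha]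
  · intro S
    rw [weight_zLabel, pdist_diagOp_zLabel]

lemma qEntropy_diagOp (n : ℕ) (f : (Fin n → Bool) → ℝ) :
    qEntropy 2 n (diagOp n f) = boolEntropy n f := by
  refine congrArg Neg.neg
    (Fintype.sum_of_injective (zLabel n) (zLabel_injective n) _ _ ?_ ?_).symm
  · intro a ha
    simp [pdist_diagOp_eq_zero f ha]
  · intro S
    rw [pdist_diagOp_zLabel]

/-- **QFEI implies FEI**: if every Hermitian `O` with `O² = I` satisfies `H[O] ≤ c I[O]`,
then every Boolean function `f : {-1,1}^n → {-1,1}` satisfies `H[f] ≤ c I[f]`. -/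
theorem qfei_implies_fei (n : ℕ) (hn : 1 ≤ n) (c : ℝ) (hc : 0 ≤ c)
    (hq : ∀ O : QOp 2 n, O.IsHermitian → O * O = 1 →
      qEntropy 2 n O ≤ c * influence 2 n O) :
    ∀ f : (Fin n → Bool) → ℝ, (∀ x, f x = 1 ∨ f x = -1) →
      boolEntropy n f ≤ c * boolInfluence n f := by
  intro f hf
  simpa only [qEntropy_diagOp, influence_diagOp] using
    hq (diagOp n f) (diagOp_isHermitian n f) (diagOp_mul_self n hf)

end QC
end
end
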